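/- Let W = (P,[n]) be an admissible Wilson loop diagram. Then the number of + entries in the Le diagram of W equals 3|P|; equivalently, the dimension of the positroid cell of M(W) in the nonnegative real Grassmannian Gr_{≥0}(|P|, n) is three times the number of propagators of W. -/

import Mathlib

open scoped Classical

namespace WLD

/-- A propagator of a Wilson loop diagram on the cyclically ordered vertex set
`ZMod n` (vertex `n` is identified with `0`): an unordered pair of edges, the
edge joining vertex `i` to vertex `i+1` being labelled `i`. -/
abbrev Prp (n : ℕ) := Sym2 (ZMod n)

variable (n : ℕ)

/-- The position of `x` in the linear order `i <_i i+1 <_i ⋯ <_i i-1`. -/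
def ord (i x : ZMod n) : ℕ := (x - i).val

/-- The other end of a propagator `p` having an end on the edge `e`. -/
noncomputable def otherEnd (p : Prp n) (e : ZMod n) : ZMod n :=
  if h : e ∈ p then Sym2.Mem.other h else e

/-- The vertex support `V(p) = {i, i+1, j, j+1}` of the propagator `p = (i,j)`. -/
def supp (p : Prp n) : Finset (ZMod n) :=
  Sym2.lift ⟨fun i j => {i, i + 1, j, j + 1}, fun i j => by
    ext x
    simp only [Finset.mem_insert, Finset.mem_singleton]
    tauto⟩ p

/-- The vertex support `V(Q)` of a set of propagators. -/
def suppSet (Q : Finset (Prp n)) : Finset (ZMod n) := Q.biUnion (supp n)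

/-- `Prop(U)`: the propagators of `P` supported on (a vertex of) `U`. -/
noncomputable def propsOn (P : Finset (Prp n)) (U : Finset (ZMod n)) : Finset (Prp n) :=
  P.filter fun p => (supp n p ∩ U).Nonempty

/-- Two propagators `p = (i,j)` and `q = (k,l)` cross if `i < k < j < l` cyclically. -/
def Crossing (p q : Prp n) : Prop :=
  ∃ i j k l : ZMod n, p = s(i, j) ∧ q = s(k, l) ∧
    0 < ord n i k ∧ ord n i k < ord n i j ∧ ord n i j < ord n i l

/-- Weak admissibility of a Wilson loop diagram. -/
structure IsWeaklyAdmissible (P : Finset (Prp n)) : Prop where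
  dense : ∀ Q ⊆ P, Q.Nonempty → Q.card + 3 ≤ (suppSet n Q).card
  noncross : ∀ p ∈ P, ∀ q ∈ P, ¬ Crossing n p q

/-- Admissibility of a Wilson loop diagram. -/
structure IsAdmissible (P : Finset (Prp n)) : Prop where
  card_add_four_le : P.card + 4 ≤ n
  dense : ∀ Q ⊆ P, Q.Nonempty → Q.card + 3 ≤ (suppSet n Q).card
  noncross : ∀ p ∈ P, ∀ q ∈ P, ¬ Crossing n p q

/-- The length of a propagator `p = (i,j)`:
`min(|[i+1, j]|, |[j+1, i]|)`, the number of vertices on its smaller side. -/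
def plength (p : Prp n) : ℕ :=
  Sym2.lift ⟨fun i j => min ((j - i - 1).val + 1) ((i - j - 1).val + 1),
    fun _ _ => min_comm _ _⟩ p

/-- `InsideDir n i p q` : the propagator `q = (k,l)` lies (weakly) inside the
propagator `p = (i,j)` directed from its end `i`, i.e. `i ≤_i k <_i l ≤_i j`. -/
def InsideDir (i : ZMod n) (p q : Prp n) : Prop :=
  ∃ j k l : ZMod n, p = s(i, j) ∧ q = s(k, l) ∧
    ord n i k < ord n i l ∧ ord n i l ≤ ord n i j

/-- Sorting key measuring how far clockwise of the vertex `a` the relevant end of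
a propagator supported on `a` is attached: ends on the edge `a-1` are clockwise of
ends on the edge `a`, and on a fixed edge an end is the more clockwise the larger
the propagator is (nestedness of noncrossing propagators sharing an edge). -/
noncomputable def cwKey (a : ZMod n) (p : Prp n) : ℕ :=
  if a - 1 ∈ p then n + ord n (a - 1) (otherEnd n p (a - 1))
  else ord n a (otherEnd n p a)

/-- The clockwise-most propagator of `S` supported on the vertex `a`, if any. -/
noncomputable def pickCW (S : Finset (Prp n)) (a : ZMod n) : Option (Prp n) :=
  if h : (S.filter fun p => a ∈ supp n p).Nonempty then
    some (Classical.choose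
      ((S.filter fun p => a ∈ supp n p).exists_max_image (cwKey n a) h))
  else none

/-- The Grassmann necklace algorithm started at the vertex `i`: after `t` steps,
`(gnRun n P i t).1` is the set of propagators not yet deleted, and
`(gnRun n P i t).2` records the vertex assigned to each deleted propagator.
Step `t+1` processes the vertex `i + t`: if some not-yet-deleted propagator is
supported on it, the clockwise-most such propagator is deleted and assigned
that vertex. -/
noncomputable def gnRun (P : Finset (Prp n)) (i : ZMod n) :
    ℕ → Finset (Prp n) × (Prp n → Option (ZMod n))
  | 0 => (P, fun _ => none)
  | t + 1 =>
    match pickCW n (gnRun P i t).1 (i + (t : ZMod n)) with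
    | none => gnRun P i t
    | some p => ((gnRun P i t).1.erase p,
        Function.update (gnRun P i t).2 p (some (i + (t : ZMod n))))

/-- `I_i^W(p)`: the vertex contributed by the propagator `p` to the Grassmann
necklace term `I_i^W` (as an `Option`; the algorithm makes one full circuit of
the vertex set, i.e. runs for `n` steps). -/
noncomputable def gnAssign (P : Finset (Prp n)) (i : ZMod n) (p : Prp n) :
    Option (ZMod n) :=
  (gnRun n P i n).2 p

/-- The Grassmann necklace term `I_i^W` produced by the algorithm. -/
noncomputable def gnSet [NeZero n] (P : Finset (Prp n)) (i : ZMod n) :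
    Finset (ZMod n) :=
  Finset.univ.filter fun v => ∃ p, gnAssign n P i p = some v

/-- The cyclic interval `{a, a+1, …, a + (len-1)}` in `ZMod n`. -/
def cInterval [NeZero n] (a : ZMod n) (len : ℕ) : Finset (ZMod n) :=
  Finset.univ.filter fun x => ord n a x < len

/-- A Grassmann necklace of type `(k, n)`: a cyclic sequence of `k`-element
subsets of the vertex set such that `I_{i+1} = (I_i \ {i}) ∪ {j}` for some `j`
whenever `i ∈ I_i`, and `I_{i+1} = I_i` otherwise. -/
def IsGrassmannNecklace [NeZero n] (k : ℕ) (I : ZMod n → Finset (ZMod n)) : Prop :=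
  (∀ i, (I i).card = k) ∧
  ∀ i : ZMod n,
    (i ∈ I i → ∃ j : ZMod n, I (i + 1) = insert j ((I i).erase i)) ∧
    (i ∉ I i → I (i + 1) = I i)

/-- Independence in the matroid `M(W)`: no subset `U` of `J` supports fewer
propagators than the vertices it contains. -/
def Indep (P : Finset (Prp n)) (J : Finset (ZMod n)) : Prop :=
  ∀ U ⊆ J, U.card ≤ (propsOn n P U).card

/-- `A` is lexicographically smaller than `B` with respect to the order `<_i`:
the `<_i`-least element of the symmetric difference lies in `A`. -/
def LexLt (i : ZMod n) (A B : Finset (ZMod n)) : Prop :=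
  ∃ v, v ∈ A ∧ v ∉ B ∧ ∀ w, ord n i w < ord n i v → (w ∈ A ↔ w ∈ B)

/-- A `+` is placed in the box `(a, b)` of the Le diagram with row labels `I₁`
by the necklace term `Ii`: writing `I₁ \ Ii = {a₁ > ⋯ > a_r}` and
`Ii \ I₁ = {b₁ < ⋯ < b_r}` in the `<₁` order, the plusses are in the boxes
`(a_t, b_t)`. -/
def LePlusAt (I₁ Ii : Finset (ZMod n)) (a b : ZMod n) : Prop :=
  a ∈ I₁ \ Ii ∧ b ∈ Ii \ I₁ ∧
    ((I₁ \ Ii).filter fun x => ord n 1 a < ord n 1 x).card =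
      ((Ii \ I₁).filter fun y => ord n 1 y < ord n 1 b).card

/-- The box `(a, b)` of the Le diagram of the diagram `P` contains a `+`. -/
def LePlus [NeZero n] (P : Finset (Prp n)) (a b : ZMod n) : Prop :=
  ∃ i : ZMod n, LePlusAt n (gnSet n P 1) (gnSet n P i) a b

/-- The number of `+` entries in the Le diagram of the diagram `P`. -/
noncomputable def plusCount [NeZero n] (P : Finset (Prp n)) : ℕ :=
  (Finset.univ.filter fun ab : ZMod n × ZMod n => LePlus n P ab.1 ab.2).card

/-- The length of the row labelled `a` of the Young diagram with row labels `I₁`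
(the boxes of row `a` are indexed by the column labels `b ∉ I₁` with `a <₁ b`). -/
noncomputable def rowLen [NeZero n] (I₁ : Finset (ZMod n)) (a : ZMod n) : ℕ :=
  (Finset.univ.filter fun b => b ∉ I₁ ∧ ord n 1 a < ord n 1 b).card

/-- The entry of the matrix `C(W)` in row `p` and column `q`: the indeterminate
`x_{p,q}` if `q ∈ V(p)`, and `0` otherwise. -/
noncomputable def CW (p : Prp n) (q : ZMod n) : MvPolynomial (Prp n × ZMod n) ℝ :=
  if q ∈ supp n p then MvPolynomial.X (p, q) else 0

/-- The column paired with the row `p` in the minors determined by `I_i^W`. -/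
noncomputable def colOf (P : Finset (Prp n)) (i : ZMod n) (p : Prp n) : ZMod n :=
  (gnAssign n P i p).getD i

/-- `Δ_{I_i}`: the determinant of the `k × k` minor of `C(W)` on the columns
indexed by `I_i^W`, rows and columns paired via the necklace assignment. -/
noncomputable def Delta (P : Finset (Prp n)) (i : ZMod n) :
    MvPolynomial (Prp n × ZMod n) ℝ :=
  Matrix.det (Matrix.of fun p q : ↥P => CW n (p : Prp n) (colOf n P i (q : Prp n)))

/-- `S_i`: the propagators whose contribution changes from `I_{i-1}` to `I_i`. -/
noncomputable def Schanged (P : Finset (Prp n)) (i : ZMod n) : Finset (Prp n) :=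
  P.filter fun p => gnAssign n P (i - 1) p ≠ gnAssign n P i p

/-- `r_i`: the determinant of the minor of `C(W)` with rows indexed by `S_i` and
columns indexed by `I_i(S_i)` (equal to `1` when `S_i = ∅`). -/
noncomputable def rfac (P : Finset (Prp n)) (i : ZMod n) :
    MvPolynomial (Prp n × ZMod n) ℝ :=
  Matrix.det
    (Matrix.of fun p q : ↥(Schanged n P i) => CW n (p : Prp n) (colOf n P i (q : Prp n)))

/-- `R = ∏ᵢ rᵢ`, the polynomial produced by the algorithm. -/
noncomputable def Rpoly [NeZero n] (P : Finset (Prp n)) :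
    MvPolynomial (Prp n × ZMod n) ℝ :=
  ∏ i : ZMod n, rfac n P i

/-- Position of the end of the propagator `p` along the edge `e`: larger values
attach closer to the vertex `e`, i.e. earlier in the counterclockwise ordering
of the ends of propagators along the edge `e`. -/
noncomputable def edgeKey (e : ZMod n) (p : Prp n) : ℕ := ord n e (otherEnd n p e)

/-- The propagators of `P` with an end on the edge `e`. -/
noncomputable def onEdge (P : Finset (Prp n)) (e : ZMod n) : Finset (Prp n) :=
  P.filter fun p => e ∈ p

/-- `p` is the first propagator (`p₁`) on the edge `e` in the counterclockwise
ordering of the propagators with an end on the edge `e`. -/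
def IsCcwFirst (P : Finset (Prp n)) (e : ZMod n) (p : Prp n) : Prop :=
  p ∈ onEdge n P e ∧ ∀ q ∈ onEdge n P e, edgeKey n e q ≤ edgeKey n e p

/-- `p` is the last propagator (`p_r`) on the edge `e` in the counterclockwise
ordering of the propagators with an end on the edge `e`. -/
def IsCcwLast (P : Finset (Prp n)) (e : ZMod n) (p : Prp n) : Prop :=
  p ∈ onEdge n P e ∧ ∀ q ∈ onEdge n P e, edgeKey n e p ≤ edgeKey n e q

/-- `p` and `q` are consecutive, in this order (`p = p_j`, `q = p_{j+1}`), in the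
counterclockwise ordering of the propagators with an end on the edge `e`. -/
def ConsecOnEdge (P : Finset (Prp n)) (e : ZMod n) (p q : Prp n) : Prop :=
  p ∈ onEdge n P e ∧ q ∈ onEdge n P e ∧ edgeKey n e q < edgeKey n e p ∧
    ∀ r ∈ onEdge n P e, ¬ (edgeKey n e q < edgeKey n e r ∧ edgeKey n e r < edgeKey n e p)

/-- The factor `R_e` of the denominator `R(W)` associated to the edge `e`:
`R_e = x_{p₁,e+1} • ∏_{j=1}^{r-1} (x_{p_j,e} x_{p_{j+1},e+1} - x_{p_{j+1},e} x_{p_j,e+1}) • x_{p_r,e}`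
for the counterclockwise ordering `p₁, …, p_r` of the propagators on the edge `e`
(`R_e = 1` if there are none). -/
noncomputable def Redge (P : Finset (Prp n)) (e : ZMod n) :
    MvPolynomial (Prp n × ZMod n) ℝ :=
  (∏ p ∈ (onEdge n P e).filter (IsCcwFirst n P e), MvPolynomial.X (p, e + 1)) *
    (∏ pq ∈ (P ×ˢ P).filter (fun pq => ConsecOnEdge n P e pq.1 pq.2),
      (MvPolynomial.X (pq.1, e) * MvPolynomial.X (pq.2, e + 1) -
        MvPolynomial.X (pq.2, e) * MvPolynomial.X (pq.1, e + 1))) *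
    (∏ p ∈ (onEdge n P e).filter (IsCcwLast n P e), MvPolynomial.X (p, e))

/-- The denominator `R(W) = ∏ₑ R_e` of the integrand `Ω(W)`. -/
noncomputable def RW [NeZero n] (P : Finset (Prp n)) :
    MvPolynomial (Prp n × ZMod n) ℝ :=
  ∏ e : ZMod n, Redge n P e

/-- The relabelling map associated to the removal of the vertex `i` from the
vertex set `ZMod n`: the vertex of `ZMod (n-1)` in position `t` (in the `<₁`
order) is sent to the vertex of `ZMod n` in position `t` if `t` precedes the
position of `i`, and to the vertex in position `t+1` otherwise. -/
noncomputable def liftVert (i : ZMod n) (x : ZMod (n - 1)) : ZMod n :=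
  1 + ((if ord (n - 1) 1 x < ord n 1 i then ord (n - 1) 1 x
        else ord (n - 1) 1 x + 1 : ℕ) : ZMod n)

end WLD
namespace WLD

/-- The vertices `c q, c q + 1, d q, d q + 1` in `[v, m]` met by the members of `R`. -/
def nbhd {ι : Type*} (c d : ι → ℕ) (v m : ℕ) (R : Finset ι) : Finset ℕ :=
  (R.biUnion fun q => {c q, c q + 1, d q, d q + 1}) ∩ Finset.Icc v m

lemma mem_nbhd {ι : Type*} {c d : ι → ℕ} {v m : ℕ} {R : Finset ι} {x : ℕ} :
    x ∈ nbhd c d v m R ↔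
      (∃ q ∈ R, x = c q ∨ x = c q + 1 ∨ x = d q ∨ x = d q + 1) ∧ v ≤ x ∧ x ≤ m := by
  simp [nbhd]

lemma hall_step {ι : Type*} [DecidableEq ι] (c d : ι → ℕ) (S : Finset ι) (v m : ℕ) (hv : 1 ≤ v) (r : ι)
    (hrS : r ∈ S)
    (hcd : ∀ q ∈ S, c q + 2 ≤ d q)
    (hnc : ∀ q ∈ S, ∀ q' ∈ S, ¬ (c q < c q' ∧ c q' < d q ∧ d q < d q'))
    (hdense : ∀ R ⊆ S, R.Nonempty →
      R.card + 3 ≤ (R.biUnion fun q => ({c q, c q + 1, d q, d q + 1} : Finset ℕ)).card)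
    (hr : v = c r ∨ v = c r + 1 ∨ v = d r ∨ v = d r + 1)
    (h1 : c r + 1 ≠ v → d r + 1 ≠ v → ∀ q ∈ S, c q + 1 ≠ v ∧ d q + 1 ≠ v)
    (h2 : c r + 1 = v → ∀ q ∈ S, d q + 1 ≠ v ∧ (c q + 1 = v → d q ≤ d r))
    (h3 : c r = v → ∀ q ∈ S, d q ≠ v ∧ (c q = v → d q ≤ d r))
    (hmr : d r ≤ m)
    (hall : ∀ R ⊆ S, R.card ≤ (nbhd c d v m R).card) :
    ∀ R ⊆ S.erase r, R.card ≤ (nbhd c d (v + 1) m R).card := by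
  intro R hR
  by_contra! hlt
  have hRS : R ⊆ S := hR.trans (Finset.erase_subset _ _)
  have hrR : r ∉ R := fun h => by simpa using hR h
  have hall_R := hall R hRS
  have hvN : v ∈ nbhd c d v m R := by
    by_contra hv'
    have : nbhd c d v m R ⊆ nbhd c d (v + 1) m R := by
      intro x hx
      have hxv : x ≠ v := fun h => hv' (h ▸ hx)
      rw [mem_nbhd] at hx ⊢
      exact ⟨hx.1, by omega, hx.2.2⟩
    have := Finset.card_le_card this
    omega
  have hle : (nbhd c d v m R).card ≤ R.card := by
    have : nbhd c d v m R ⊆ insert v (nbhd c d (v + 1) m R) := by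
      intro x hx
      rw [Finset.mem_insert, mem_nbhd]
      rw [mem_nbhd] at hx
      by_cases hxv : x = v
      · exact Or.inl hxv
      · exact Or.inr ⟨hx.1, by omega, hx.2.2⟩
    have := (Finset.card_le_card this).trans (Finset.card_insert_le _ _)
    omega
  obtain ⟨⟨q₀, hq₀, hq₀v⟩, -, hvm⟩ := mem_nbhd.1 hvN
  have hir : insert r R ⊆ S := Finset.insert_subset hrS hRS
  have hcr := hcd r hrS
  by_cases hsub : nbhd c d v m (insert r R) ⊆ nbhd c d v m R
  · have a := hall _ hir
    rw [Finset.card_insert_of_notMem hrR] at a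
    have := Finset.card_le_card hsub
    omega
  have hc : c r = v ∨ c r + 1 = v := by
    by_contra! hne
    apply hsub
    intro x hx
    rw [mem_nbhd] at hx ⊢
    obtain ⟨⟨q, hq, hqx⟩, hvx, hxm⟩ := hx
    rcases Finset.mem_insert.1 hq with rfl | hq
    · rcases (by omega : d q = v ∨ d q + 1 = v) with hd | hd
      · have := h1 (by omega) (by omega) q₀ (hRS hq₀)
        exact ⟨⟨q₀, hq₀, by omega⟩, hvx, hxm⟩
      · exact ⟨⟨q₀, hq₀, by omega⟩, hvx, hxm⟩
    · exact ⟨⟨q, hq, hqx⟩, hvx, hxm⟩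
  have hon : ∀ q ∈ R, v = c q ∨ v = c q + 1 ∨ v = d q ∨ v = d q + 1 →
      c r ≤ c q ∧ d q ≤ d r := by
    intro q hq hqv
    have a1 := hcd q (hRS hq)
    have a2 := hnc q (hRS hq) r hrS
    have a3 := hnc r hrS q (hRS hq)
    rcases hc with hc | hc
    · have b1 := h1 (by omega) (by omega) q (hRS hq)
      have b3 := h3 hc q (hRS hq)
      refine ⟨by omega, b3.2 (by omega)⟩
    · have b2 := h2 hc q (hRS hq)
      have : c q + 1 = v ∨ c q = v := by omega
      rcases this with e | e
      · exact ⟨by omega, b2.2 e⟩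
      · exact ⟨by omega, by omega⟩
  set R₁ := R.filter fun q => c r ≤ c q ∧ d q ≤ d r with hR₁
  set R₂ := R.filter fun q => ¬ (c r ≤ c q ∧ d q ≤ d r) with hR₂
  have hcard : R₁.card + R₂.card = R.card := Finset.card_filter_add_card_filter_not _
  have hR₁R : R₁ ⊆ R := Finset.filter_subset _ _
  have hR₂R : R₂ ⊆ R := Finset.filter_subset _ _
  have hq₀R₁ : q₀ ∈ R₁ := by
    rw [hR₁, Finset.mem_filter]
    exact ⟨hq₀, hon q₀ hq₀ hq₀v⟩
  have hN₂ := hall R₂ (hR₂R.trans hRS)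
  have hV := hdense (insert r R₁) (Finset.insert_subset hrS (hR₁R.trans hRS))
    (Finset.insert_nonempty _ _)
  rw [Finset.card_insert_of_notMem fun h => hrR (hR₁R h)] at hV
  have hsubV : ((insert r R₁).biUnion fun q => ({c q, c q + 1, d q, d q + 1} : Finset ℕ)) ⊆
      insert (v - 1) (nbhd c d v m R₁ \ {d r, d r + 1} ∪ {d r, d r + 1}) := by
    intro x hx
    simp only [Finset.mem_biUnion, Finset.mem_insert, Finset.mem_singleton,
      Finset.mem_union, Finset.mem_sdiff, mem_nbhd] at hx ⊢
    by_cases hxd : x = d r ∨ x = d r + 1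
    · exact Or.inr (Or.inr hxd)
    by_cases hxv : x = v - 1
    · exact Or.inl hxv
    refine Or.inr (Or.inl ⟨?_, hxd⟩)
    obtain ⟨q, rfl | hq, hqx⟩ := hx
    · refine ⟨⟨q₀, hq₀R₁, ?_⟩, by omega, by omega⟩
      rcases hc with hc | hc
      · have b1 := h1 (by omega) (by omega) q₀ (hRS hq₀)
        have b3 := h3 hc q₀ (hRS hq₀)
        omega
      · omega
    · have e := (Finset.mem_filter.1 hq).2
      have a1 := hcd q (hRS (hR₁R hq))
      exact ⟨⟨q, hq, hqx⟩, by omega, by omega⟩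
  have hc1 := Finset.card_le_card hsubV
  have hc2 := Finset.card_insert_le (v - 1) (nbhd c d v m R₁ \ {d r, d r + 1} ∪ {d r, d r + 1})
  have hc3 := Finset.card_union_le (nbhd c d v m R₁ \ {d r, d r + 1}) {d r, d r + 1}
  have hc4 : ({d r, d r + 1} : Finset ℕ).card = 2 := Finset.card_pair (by omega)
  have hdisj : Disjoint (nbhd c d v m R₁ \ {d r, d r + 1}) (nbhd c d v m R₂) := by
    rw [Finset.disjoint_left]
    intro x hx hx2
    simp only [Finset.mem_insert, Finset.mem_singleton, Finset.mem_sdiff, mem_nbhd] at hx hx2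
    obtain ⟨⟨⟨q, hq, hqx⟩, hvx, hxm⟩, hxd⟩ := hx
    obtain ⟨⟨q', hq', hqx'⟩, -⟩ := hx2
    have e := (Finset.mem_filter.1 hq).2
    have e' := (Finset.mem_filter.1 hq').2
    have o := hon q' (hR₂R hq')
    have a1 := hcd q (hRS (hR₁R hq))
    have a1' := hcd q' (hRS (hR₂R hq'))
    have a2 := hnc q' (hRS (hR₂R hq')) r hrS
    have a3 := hnc r hrS q' (hRS (hR₂R hq'))
    have o' : ¬ (v = c q' ∨ v = c q' + 1 ∨ v = d q' ∨ v = d q' + 1) := fun h => e' (o h)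
    omega
  have hc5 : (nbhd c d v m R₁ \ {d r, d r + 1} ∪ nbhd c d v m R₂).card ≤
      (nbhd c d v m R).card := by
    apply Finset.card_le_card
    intro x hx
    simp only [Finset.mem_union, Finset.mem_sdiff, mem_nbhd] at hx ⊢
    rcases hx with ⟨⟨⟨q, hq, h⟩, h'⟩, -⟩ | ⟨⟨q, hq, h⟩, h'⟩
    · exact ⟨⟨q, hR₁R hq, h⟩, h'⟩
    · exact ⟨⟨q, hR₂R hq, h⟩, h'⟩
  rw [Finset.card_union_of_disjoint hdisj] at hc5
  omega

section Frame

variable {n : ℕ} [NeZero n]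

lemma ord_lt (a x : ZMod n) : ord n a x < n := ZMod.val_lt _

lemma add_ord (a x : ZMod n) : a + (ord n a x : ZMod n) = x := by
  simp [ord]

omit [NeZero n] in
lemma ord_add_cast (a : ZMod n) {x : ℕ} (hx : x < n) : ord n a (a + (x : ZMod n)) = x := by
  simp [ord, ZMod.val_natCast, Nat.mod_eq_of_lt hx]

omit [NeZero n] in
lemma ord_add_add {a : ZMod n} {x y : ℕ} (hxy : x ≤ y) (hy : y < n) :
    ord n (a + (x : ZMod n)) (a + (y : ZMod n)) = y - x := by
  have : a + (y : ZMod n) = a + (x : ZMod n) + ((y - x : ℕ) : ZMod n) := by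
    rw [Nat.cast_sub hxy]; ring
  rw [this, ord_add_cast _ (by omega)]

omit [NeZero n] in
lemma ord_add_add_of_lt {a : ZMod n} {x y : ℕ} (hxy : x < y) (hy : y < n) :
    ord n (a + (y : ZMod n)) (a + (x : ZMod n)) = n - (y - x) := by
  have : a + (x : ZMod n) = a + (y : ZMod n) + ((n - (y - x) : ℕ) : ZMod n) := by
    rw [Nat.cast_sub (by omega), Nat.cast_sub hxy.le, ZMod.natCast_self]; ring
  rw [this, ord_add_cast _ (by omega)]

omit [NeZero n] in
lemma add_cast_inj (a : ZMod n) {x y : ℕ} (hx : x < n) (hy : y < n) :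
    a + (x : ZMod n) = a + (y : ZMod n) ↔ x = y := by
  refine ⟨fun h => ?_, fun h => h ▸ rfl⟩
  rw [← ord_add_cast a hx, ← ord_add_cast a hy, h]

omit [NeZero n] in
lemma mem_supp_mk {x y v : ZMod n} :
    v ∈ supp n s(x, y) ↔ v = x ∨ v = x + 1 ∨ v = y ∨ v = y + 1 := by
  simp [supp]

omit [NeZero n] in
lemma otherEnd_mk (x y : ZMod n) : otherEnd n s(x, y) x = y := by
  have h : x ∈ s(x, y) := Sym2.mem_mk_left x y
  rw [otherEnd, dif_pos h]
  exact Sym2.congr_right.1 (Sym2.other_spec h)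

omit [NeZero n] in
lemma cwKey_succ (x y : ZMod n) : cwKey n (x + 1) s(x, y) = n + ord n x y := by
  simp [cwKey, otherEnd_mk]

omit [NeZero n] in
lemma cwKey_self {x y : ZMod n} (h : x - 1 ∉ s(x, y)) : cwKey n x s(x, y) = ord n x y := by
  rw [cwKey, if_neg h, otherEnd_mk]

omit [NeZero n] in
lemma supp_frame {a : ZMod n} {c d x : ℕ} (hcd : c < d) (hd : d < n) (hx : x < n) (hx1 : 1 ≤ x) :
    a + (x : ZMod n) ∈ supp n s(a + (c : ZMod n), a + (d : ZMod n)) ↔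
      x = c ∨ x = c + 1 ∨ x = d ∨ x = d + 1 := by
  rw [mem_supp_mk, add_cast_inj a hx (by omega), add_cast_inj a hx hd]
  have e1 : a + (c : ZMod n) + 1 = a + ((c + 1 : ℕ) : ZMod n) := by push_cast; ring
  rw [e1, add_cast_inj a hx (by omega)]
  rcases Nat.lt_or_ge (d + 1) n with h | h
  · have e2 : a + (d : ZMod n) + 1 = a + ((d + 1 : ℕ) : ZMod n) := by push_cast; ring
    rw [e2, add_cast_inj a hx h]
  · have e2 : a + (d : ZMod n) + 1 = a + ((0 : ℕ) : ZMod n) := by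
      have : ((d + 1 : ℕ) : ZMod n) = 0 := by
        rw [show d + 1 = n by omega, ZMod.natCast_self]
      push_cast at this ⊢
      rw [add_assoc, this]
    rw [e2, add_cast_inj a hx (by omega)]
    omega

omit [NeZero n] in
lemma cwKey_frame_left {a : ZMod n} {c d : ℕ} (hcd : c < d) (hd : d < n) :
    cwKey n (a + ((c + 1 : ℕ) : ZMod n)) s(a + (c : ZMod n), a + (d : ZMod n)) = n + (d - c) := by
  rw [← ord_add_add hcd.le hd (a := a), ← cwKey_succ]
  push_cast; rw [add_assoc]

omit [NeZero n] in
lemma cwKey_frame_right {a : ZMod n} {c d : ℕ} (hcd : c < d) (hd : d < n) :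
    cwKey n (a + ((d + 1 : ℕ) : ZMod n)) s(a + (c : ZMod n), a + (d : ZMod n)) =
      n + (n - (d - c)) := by
  rw [← ord_add_add_of_lt hcd hd (a := a), ← cwKey_succ, Sym2.eq_swap]
  push_cast; rw [add_assoc]

omit [NeZero n] in
lemma sub_one_notMem_frame {a : ZMod n} {c d x : ℕ} (hc : c < n) (hd : d < n)
    (hx : x + 1 < n) (h1 : x ≠ c) (h2 : x ≠ d) :
    a + ((x + 1 : ℕ) : ZMod n) - 1 ∉ s(a + (c : ZMod n), a + (d : ZMod n)) := by
  have : a + ((x + 1 : ℕ) : ZMod n) - 1 = a + (x : ZMod n) := by push_cast; ring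
  rw [this, Sym2.mem_iff, add_cast_inj a (by omega) hc, add_cast_inj a (by omega) hd]
  omega

omit [NeZero n] in
lemma cwKey_frame_left_self {a : ZMod n} {c d : ℕ} (hc : 1 ≤ c) (hcd : c < d) (hd : d < n) :
    cwKey n (a + (c : ZMod n)) s(a + (c : ZMod n), a + (d : ZMod n)) = d - c := by
  obtain ⟨c, rfl⟩ : ∃ c', c = c' + 1 := ⟨c - 1, by omega⟩
  rw [← ord_add_add hcd.le hd (a := a), cwKey_self]
  exact sub_one_notMem_frame (by omega) hd (by omega) (by omega) (by omega)

omit [NeZero n] in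
lemma cwKey_frame_right_self {a : ZMod n} {c d : ℕ} (hcd : c + 2 ≤ d) (hd : d < n) :
    cwKey n (a + (d : ZMod n)) s(a + (c : ZMod n), a + (d : ZMod n)) = n - (d - c) := by
  obtain ⟨d, rfl⟩ : ∃ d', d = d' + 1 := ⟨d - 1, by omega⟩
  rw [← ord_add_add_of_lt (by omega : c < d + 1) hd (a := a), Sym2.eq_swap, cwKey_self]
  exact sub_one_notMem_frame hd (by omega) (by omega) (by omega) (by omega)

lemma exists_frame {P : Finset (Prp n)} (hadm : IsAdmissible n P) {q : Prp n} (hq : q ∈ P)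
    (a : ZMod n) : ∃ c d : ℕ, c + 2 ≤ d ∧ d + 2 ≤ c + n ∧ d < n ∧
      q = s(a + (c : ZMod n), a + (d : ZMod n)) := by
  have hn := hadm.card_add_four_le
  have key : ∀ x y : ZMod n, s(x, y) ∈ P → x ≠ y ∧ x + 1 ≠ y ∧ y + 1 ≠ x := by
    intro x y hxy
    have h := hadm.dense {s(x, y)} (by simpa using hxy) (by simp)
    have h4 : 4 ≤ (supp n s(x, y)).card := by simpa [suppSet] using h
    have h3 : ∀ u v w : ZMod n, supp n s(x, y) ⊆ {u, v, w} → False := by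
      intro u v w hs
      have := (Finset.card_le_card hs).trans Finset.card_le_three
      omega
    refine ⟨fun e => h3 x (x + 1) x ?_, fun e => h3 x y (y + 1) ?_, fun e => h3 x (x + 1) y ?_⟩
    all_goals
      intro v hv
      rw [mem_supp_mk] at hv
      simp only [Finset.mem_insert, Finset.mem_singleton]
      grind
  have main : ∀ x y : ZMod n, s(x, y) ∈ P → ord n a x < ord n a y →
      ∃ c d : ℕ, c + 2 ≤ d ∧ d + 2 ≤ c + n ∧ d < n ∧
        s(x, y) = s(a + (c : ZMod n), a + (d : ZMod n)) := by
    intro x y hxy hlt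
    obtain ⟨h1, h2, h3⟩ := key x y hxy
    refine ⟨ord n a x, ord n a y, ?_, ?_, ord_lt _ _, by rw [add_ord, add_ord]⟩
    · by_contra hc
      apply h2
      rw [← add_ord a x, ← add_ord a y, show ord n a y = ord n a x + 1 by omega]
      push_cast; ring
    · by_contra hc
      have := ord_lt a y
      have e1 : ord n a y + 1 = n := by omega
      have e2 : ord n a x = 0 := by omega
      apply h3
      rw [← add_ord a x, e2]
      nth_rw 1 [← add_ord a y]
      have : ((ord n a y + 1 : ℕ) : ZMod n) = 0 := by rw [e1, ZMod.natCast_self]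
      push_cast at this
      rw [add_assoc, this]; simp
  induction q using Sym2.ind with
  | _ x y =>
    rcases lt_trichotomy (ord n a x) (ord n a y) with h | h | h
    · exact main x y hq h
    · exact absurd (by rw [← add_ord a x, h, add_ord]) (key x y hq).1
    · rw [Sym2.eq_swap] at hq ⊢
      exact main y x hq h

omit [NeZero n] in
lemma not_crossing_frame {P : Finset (Prp n)} (hadm : IsAdmissible n P) {a : ZMod n}
    {c d c' d' : ℕ} (hd' : d' < n)
    (hq : s(a + (c : ZMod n), a + (d : ZMod n)) ∈ P)
    (hq' : s(a + (c' : ZMod n), a + (d' : ZMod n)) ∈ P) :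
    ¬ (c < c' ∧ c' < d ∧ d < d') := by
  rintro ⟨h1, h2, h3⟩
  refine hadm.noncross _ hq _ hq' ⟨_, _, _, _, rfl, rfl, ?_⟩
  rw [ord_add_add h1.le (by omega), ord_add_add (by omega) (by omega),
    ord_add_add (by omega) hd']
  omega

end Frame

section Pick

variable {n : ℕ} [NeZero n] {P : Finset (Prp n)} {S S' : Finset (Prp n)} {v : ZMod n} {r : Prp n}

lemma cwKey_injOn (hadm : IsAdmissible n P) {q q' : Prp n} (hq : q ∈ P) (hq' : q' ∈ P)
    (hv : v ∈ supp n q) (hv' : v ∈ supp n q') (h : cwKey n v q = cwKey n v q') : q = q' := by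
  have hn := hadm.card_add_four_le
  obtain ⟨c, d, h1, h2, h3, rfl⟩ := exists_frame hadm hq (v - 1)
  obtain ⟨c', d', h1', h2', h3', rfl⟩ := exists_frame hadm hq' (v - 1)
  have ev : v = v - 1 + ((1 : ℕ) : ZMod n) := by simp
  generalize v - 1 = a at *
  subst ev
  rw [supp_frame (by omega) h3 (by omega) le_rfl] at hv
  rw [supp_frame (by omega) h3' (by omega) le_rfl] at hv'
  have k0 : ∀ d : ℕ, 0 < d → d < n → cwKey n (a + ((1 : ℕ) : ZMod n))
      s(a + ((0 : ℕ) : ZMod n), a + (d : ZMod n)) = n + (d - 0) := fun d h0 hd =>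
    cwKey_frame_left h0 hd
  have k1 : ∀ d : ℕ, 1 < d → d < n → cwKey n (a + ((1 : ℕ) : ZMod n))
      s(a + ((1 : ℕ) : ZMod n), a + (d : ZMod n)) = d - 1 := fun d h0 hd =>
    cwKey_frame_left_self le_rfl h0 hd
  rcases (by omega : c = 0 ∨ c = 1) with rfl | rfl <;>
  rcases (by omega : c' = 0 ∨ c' = 1) with rfl | rfl <;>
  simp only [k0 d (by omega) h3, k0 d' (by omega) h3', k1 d, k1 d', h3, h3',
    show 1 < d by omega, show 1 < d' by omega] at h
  · rw [show d = d' by omega]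
  · omega
  · omega
  · rw [show d = d' by omega]

omit [NeZero n] in
lemma pickCW_some (h : pickCW n S v = some r) :
    r ∈ S ∧ v ∈ supp n r ∧ ∀ q ∈ S, v ∈ supp n q → cwKey n v q ≤ cwKey n v r := by
  unfold pickCW at h
  split_ifs at h with hne
  have hs := Classical.choose_spec
    ((S.filter fun p => v ∈ supp n p).exists_max_image (cwKey n v) hne)
  rw [Option.some.inj h] at hs
  simp only [Finset.mem_filter] at hs
  exact ⟨hs.1.1, hs.1.2, fun q hq hqv => hs.2 q ⟨hq, hqv⟩⟩

omit [NeZero n] in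
lemma pickCW_none_iff : pickCW n S v = none ↔ ∀ q ∈ S, v ∉ supp n q := by
  unfold pickCW
  split_ifs with hne
  · obtain ⟨q, hq⟩ := hne
    rw [Finset.mem_filter] at hq
    simp only [false_iff, not_forall, not_not]
    exact ⟨q, hq.1, hq.2⟩
  · simpa [Finset.filter_eq_empty_iff] using hne

lemma pickCW_eq (hadm : IsAdmissible n P) (hS : S ⊆ P) (hr : r ∈ S) (hv : v ∈ supp n r)
    (hmax : ∀ q ∈ S, v ∈ supp n q → cwKey n v q ≤ cwKey n v r) : pickCW n S v = some r := by
  cases hp : pickCW n S v with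
  | none => exact absurd hv (pickCW_none_iff.1 hp r hr)
  | some s =>
    obtain ⟨h1, h2, h3⟩ := pickCW_some hp
    rw [cwKey_injOn hadm (hS h1) (hS hr) h2 hv (le_antisymm (hmax s h1 h2) (h3 r hr hv))]

/-- The propagators left in `S` after the vertex `v` has been processed. -/
noncomputable def serve (S : Finset (Prp n)) (v : ZMod n) : Finset (Prp n) :=
  match pickCW n S v with
  | none => S
  | some r => S.erase r

omit [NeZero n] in
lemma serve_none (h : pickCW n S v = none) : serve S v = S := by simp [serve, h]

omit [NeZero n] in
lemma serve_some (h : pickCW n S v = some r) : serve S v = S.erase r := by simp [serve, h]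

omit [NeZero n] in
lemma serve_subset : serve S v ⊆ S := by
  cases h : pickCW n S v with
  | none => rw [serve_none h]
  | some r => rw [serve_some h]; exact Finset.erase_subset _ _

lemma pickCW_insert (hadm : IsAdmissible n P) (hS : insert r S ⊆ P) :
    pickCW n (insert r S) v = some r ∨ pickCW n (insert r S) v = pickCW n S v := by
  cases hp : pickCW n (insert r S) v with
  | none =>
    right
    rw [eq_comm, pickCW_none_iff]
    exact fun q hq => pickCW_none_iff.1 hp q (Finset.mem_insert_of_mem hq)
  | some s =>
    obtain ⟨h1, h2, h3⟩ := pickCW_some hp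
    rcases Finset.mem_insert.1 h1 with rfl | h1
    · exact Or.inl rfl
    · right
      exact (pickCW_eq hadm ((Finset.subset_insert _ _).trans hS) h1 h2
        fun q hq => h3 q (Finset.mem_insert_of_mem hq)).symm

/-- If `S'` exceeds `S` by at most one propagator, then so it does after serving a vertex. -/
lemma serve_insert (hadm : IsAdmissible n P) (hS : insert r S ⊆ P) (hr : r ∉ S) :
    serve (insert r S) v = serve S v ∨
      ∃ s, s ∉ serve S v ∧ serve (insert r S) v = insert s (serve S v) := by
  rcases pickCW_insert hadm hS (v := v) with h | h
  · rw [serve_some h, Finset.erase_insert hr]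
    cases h' : pickCW n S v with
    | none => left; rw [serve_none h']
    | some s =>
      right
      refine ⟨s, ?_, ?_⟩
      · rw [serve_some h']; simp
      · rw [serve_some h', Finset.insert_erase (pickCW_some h').1]
  · right
    refine ⟨r, fun hr' => hr (serve_subset hr'), ?_⟩
    cases h' : pickCW n S v with
    | none => rw [serve_none h', serve_none (h.trans h')]
    | some s =>
      rw [serve_some h', serve_some (h.trans h'), Finset.erase_insert_of_ne]
      rintro rfl
      exact hr (pickCW_some h').1

end Pick

section Inside

variable {n : ℕ} [NeZero n] {P : Finset (Prp n)}

omit [NeZero n] in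
lemma frame_unique {a : ZMod n} {c d c' d' : ℕ} (hcd : c < d) (hd : d < n) (hcd' : c' < d')
    (hd' : d' < n) (h : s(a + (c : ZMod n), a + (d : ZMod n)) =
      s(a + (c' : ZMod n), a + (d' : ZMod n))) : c = c' ∧ d = d' := by
  rw [Sym2.eq_iff, add_cast_inj a (by omega) (by omega), add_cast_inj a (by omega) (by omega),
    add_cast_inj a (by omega) (by omega), add_cast_inj a (by omega) (by omega)] at h
  omega

/-- Processing the vertices `a + 2, …, a + m` deletes all the propagators whose ends lie between
those of `(a, a + m)`. -/
lemma inside_deleted (hadm : IsAdmissible n P) {a : ZMod n} {m : ℕ} (hm : 2 ≤ m) (hmn : m + 2 ≤ n)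
    (hp : s(a, a + (m : ZMod n)) ∈ P) (T : ℕ → Finset (Prp n)) (hTP : T 2 ⊆ P)
    (hT : ∀ y, 2 ≤ y → y ≤ m → T (y + 1) = serve (T y) (a + (y : ZMod n)))
    {c₀ d₀ : ℕ} (hcd₀ : c₀ + 2 ≤ d₀) (hd₀ : d₀ ≤ m) :
    s(a + (c₀ : ZMod n), a + (d₀ : ZMod n)) ∉ T (m + 1) := by
  choose! c d hcd hdc hdn hfr using fun q hq => exists_frame hadm (q := q) hq a
  have hp' : s(a + ((0 : ℕ) : ZMod n), a + (m : ZMod n)) ∈ P := by simpa using hp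
  have hTsub : ∀ y, 2 ≤ y → y ≤ m + 1 → T y ⊆ P := by
    intro y hy
    induction y, hy using Nat.le_induction with
    | base => exact fun _ => hTP
    | succ y hy ih =>
      intro h
      rw [hT y hy (by omega)]
      exact serve_subset.trans (ih (by omega))
  have hnc : ∀ q ∈ P, ∀ q' ∈ P, ¬ (c q < c q' ∧ c q' < d q ∧ d q < d q') := by
    intro q hq q' hq'
    have h1 := hq
    have h2 := hq'
    rw [hfr q hq] at h1
    rw [hfr q' hq'] at h2
    exact not_crossing_frame hadm (hdn q' hq') h1 h2
  have hout : ∀ q ∈ P, m < d q → c q = 0 ∨ m ≤ c q := by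
    intro q hq hlt
    have h1 := hq
    rw [hfr q hq] at h1
    have := not_crossing_frame hadm (hdn q hq) hp' h1
    omega
  have hsupp : ∀ q ∈ P, ∀ y, 2 ≤ y → y ≤ m → (a + (y : ZMod n) ∈ supp n q ↔
      y = c q ∨ y = c q + 1 ∨ y = d q ∨ y = d q + 1) := by
    intro q hq y h1 h2
    have := hcd q hq
    have h := supp_frame (a := a) (c := c q) (x := y) (by omega) (hdn q hq) (by omega) (by omega)
    rwa [← hfr q hq] at h
  have k1 : ∀ q ∈ P, ∀ y, y = c q + 1 → cwKey n (a + (y : ZMod n)) q = n + (d q - c q) := by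
    rintro q hq _ rfl
    have := hcd q hq
    have h := cwKey_frame_left (a := a) (c := c q) (by omega) (hdn q hq)
    rwa [← hfr q hq] at h
  have k2 : ∀ q ∈ P, ∀ y, y = d q + 1 → cwKey n (a + (y : ZMod n)) q = n + (n - (d q - c q)) := by
    rintro q hq _ rfl
    have := hcd q hq
    have h := cwKey_frame_right (a := a) (c := c q) (by omega) (hdn q hq)
    rwa [← hfr q hq] at h
  have k3 : ∀ q ∈ P, ∀ y, 1 ≤ y → y = c q → cwKey n (a + (y : ZMod n)) q = d q - c q := by
    rintro q hq _ h rfl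
    have := hcd q hq
    have h' := cwKey_frame_left_self (a := a) h (by omega) (hdn q hq)
    rwa [← hfr q hq] at h'
  have k4 : ∀ q ∈ P, ∀ y, y = d q → cwKey n (a + (y : ZMod n)) q = n - (d q - c q) := by
    rintro q hq _ rfl
    have := hcd q hq
    have h := cwKey_frame_right_self (a := a) (c := c q) (by omega) (hdn q hq)
    rwa [← hfr q hq] at h
  have hdense : ∀ R ⊆ P, (∀ q ∈ R, d q ≤ m) → R.Nonempty →
      R.card + 3 ≤ (R.biUnion fun q => ({c q, c q + 1, d q, d q + 1} : Finset ℕ)).card := by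
    intro R hR hRm hne
    refine (hadm.dense R hR hne).trans ((Finset.card_le_card ?_).trans
      (Finset.card_image_le (f := fun x : ℕ => a + (x : ZMod n))))
    intro v hv
    rw [suppSet, Finset.mem_biUnion] at hv
    obtain ⟨q, hq, hv⟩ := hv
    rw [hfr q (hR hq), mem_supp_mk] at hv
    simp only [Finset.mem_image, Finset.mem_biUnion, Finset.mem_insert, Finset.mem_singleton]
    rcases hv with hv | hv | hv | hv
    · exact ⟨c q, ⟨q, hq, by simp⟩, hv.symm⟩
    · exact ⟨c q + 1, ⟨q, hq, by simp⟩, by rw [hv]; push_cast; ring⟩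
    · exact ⟨d q, ⟨q, hq, by simp⟩, hv.symm⟩
    · exact ⟨d q + 1, ⟨q, hq, by simp⟩, by rw [hv]; push_cast; ring⟩
  have hall : ∀ y, 2 ≤ y → y ≤ m + 1 → ∀ R ⊆ (T y).filter (fun q => d q ≤ m),
      R.card ≤ (nbhd c d y m R).card := by
    intro y hy
    induction y, hy using Nat.le_induction with
    | base =>
      intro _ R hR
      rcases R.eq_empty_or_nonempty with rfl | hne
      · simp
      have hRP : R ⊆ P := hR.trans ((Finset.filter_subset _ _).trans hTP)
      have hRm : ∀ q ∈ R, d q ≤ m := fun q hq => (Finset.mem_filter.1 (hR hq)).2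
      have h1 := hdense R hRP hRm hne
      have h2 : (R.biUnion fun q => ({c q, c q + 1, d q, d q + 1} : Finset ℕ)) ⊆
          nbhd c d 2 m R ∪ {0, 1, m + 1} := by
        intro x hx
        simp only [Finset.mem_biUnion, Finset.mem_insert, Finset.mem_singleton] at hx
        obtain ⟨q, hq, hx⟩ := hx
        have := hRm q hq
        have := hcd q (hRP hq)
        simp only [Finset.mem_union, mem_nbhd, Finset.mem_insert, Finset.mem_singleton]
        by_cases hx' : 2 ≤ x ∧ x ≤ m
        · exact Or.inl ⟨⟨q, hq, hx⟩, hx'⟩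
        · right; omega
      have h3 := (Finset.card_le_card h2).trans (Finset.card_union_le _ _)
      have h4 : ({0, 1, m + 1} : Finset ℕ).card ≤ 3 := Finset.card_le_three
      omega
    | succ y hy ih =>
      intro hym
      have hTy := hTsub y hy (by omega)
      specialize ih (by omega)
      have hstay : (∀ q ∈ T y, d q ≤ m → a + (y : ZMod n) ∉ supp n q) →
          ∀ R ⊆ (T (y + 1)).filter (fun q => d q ≤ m), R.card ≤ (nbhd c d (y + 1) m R).card := by
        intro hno R hR
        have hsub : T (y + 1) ⊆ T y := by
          rw [hT y hy (by omega)]; exact serve_subset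
        have hR' := hR.trans (Finset.filter_subset_filter _ hsub)
        refine (ih R hR').trans (Finset.card_le_card ?_)
        intro x hx
        rw [mem_nbhd] at hx ⊢
        refine ⟨hx.1, ?_, hx.2.2⟩
        obtain ⟨⟨q, hq, hx⟩, hyx, -⟩ := hx
        obtain ⟨hqT, hqm⟩ := Finset.mem_filter.1 (hR' hq)
        have h1 := hno q hqT hqm
        rw [hsupp q (hTy hqT) y hy (by omega)] at h1
        have : x ≠ y := by rintro rfl; exact h1 hx
        omega
      cases hpick : pickCW n (T y) (a + (y : ZMod n)) with
      | none =>
        exact hstay fun q hq _ => pickCW_none_iff.1 hpick q hq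
      | some r =>
        obtain ⟨hrT, hrv, hrmax⟩ := pickCW_some hpick
        have hrP := hTy hrT
        rw [hsupp r hrP y hy (by omega)] at hrv
        have hcr := hcd r hrP
        have hdr := hdn r hrP
        by_cases hrm : d r ≤ m
        · have := hall_step c d ((T y).filter (fun q => d q ≤ m)) y m (by omega) r
            (by simp [hrT, hrm])
            (fun q hq => hcd q (hTy (Finset.mem_filter.1 hq).1))
            (fun q hq q' hq' => hnc q (hTy (Finset.mem_filter.1 hq).1) q'
              (hTy (Finset.mem_filter.1 hq').1))
            (fun R hR hne => hdense R (hR.trans ((Finset.filter_subset _ _).trans hTy))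
              (fun q hq => (Finset.mem_filter.1 (hR hq)).2) hne)
            hrv ?_ ?_ ?_ hrm ih
          · rw [hT y hy (by omega), serve_some hpick, Finset.filter_erase]
            exact this
          · intro h1 h2 q hq
            obtain ⟨hqT, hqm⟩ := Finset.mem_filter.1 hq
            have hqP := hTy hqT
            have hmax := hrmax q hqT
            rw [hsupp q hqP y hy (by omega)] at hmax
            have := hcd q hqP
            have e1 := k1 q hqP y
            have e2 := k2 q hqP y
            have e3 := k3 r hrP y (by omega)
            have e4 := k4 r hrP y
            omega
          · intro h1 q hq
            obtain ⟨hqT, hqm⟩ := Finset.mem_filter.1 hq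
            have hqP := hTy hqT
            have hmax := hrmax q hqT
            rw [hsupp q hqP y hy (by omega)] at hmax
            have := hcd q hqP
            have e1 := k1 q hqP y
            have e2 := k2 q hqP y
            have e3 := k1 r hrP y
            omega
          · intro h1 q hq
            obtain ⟨hqT, hqm⟩ := Finset.mem_filter.1 hq
            have hqP := hTy hqT
            have hmax := hrmax q hqT
            rw [hsupp q hqP y hy (by omega)] at hmax
            have := hcd q hqP
            have e1 := k3 q hqP y (by omega)
            have e2 := k4 q hqP y
            have e3 := k3 r hrP y (by omega)
            omega
        · have := hout r hrP (by omega)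
          apply hstay
          intro q hqT hqm hqv
          have hqP := hTy hqT
          have hmax := hrmax q hqT hqv
          rw [hsupp q hqP y hy (by omega)] at hqv
          have := hcd q hqP
          have e2 := k2 q hqP y
          have e4 := k4 q hqP y
          have e3 := k3 r hrP y (by omega)
          omega
  intro hmem
  have hqP := hTsub (m + 1) (by omega) le_rfl hmem
  set q := s(a + (c₀ : ZMod n), a + (d₀ : ZMod n)) with hq
  obtain ⟨-, e⟩ := frame_unique (by have := hcd q hqP; omega) (hdn q hqP) (by omega) (by omega)
    ((hfr q hqP).symm.trans hq)
  have h := hall (m + 1) (by omega) le_rfl {q} (by simp [hmem]; omega)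
  rw [Finset.card_singleton, Nat.succ_le_iff, Finset.card_pos] at h
  obtain ⟨x, hx⟩ := h
  rw [mem_nbhd] at hx
  omega

end Inside

section Run

variable {n : ℕ} [NeZero n] {P : Finset (Prp n)} {i : ZMod n} {p q : Prp n} {t x : ℕ}

/-- The propagators not yet deleted after `t` steps of the algorithm started at `i`. -/
noncomputable def remaining (P : Finset (Prp n)) (i : ZMod n) (t : ℕ) : Finset (Prp n) :=
  (gnRun n P i t).1

/-- The step of the algorithm started at `i` during which `p` is deleted. -/
noncomputable def time (P : Finset (Prp n)) (i : ZMod n) (p : Prp n) : ℕ :=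
  sInf {t | p ∉ remaining P i (t + 1)}

omit [NeZero n] in
lemma remaining_zero : remaining P i 0 = P := rfl

omit [NeZero n] in
lemma remaining_succ : remaining P i (t + 1) = serve (remaining P i t) (i + (t : ZMod n)) := by
  unfold remaining serve
  rw [gnRun]
  split <;> rfl

omit [NeZero n] in
lemma remaining_antitone : Antitone (remaining P i) :=
  antitone_nat_of_succ_le fun t => by
    rw [remaining_succ]
    exact serve_subset

omit [NeZero n] in
lemma remaining_subset : remaining P i t ⊆ P := remaining_antitone (Nat.zero_le t)

lemma notMem_remaining (hadm : IsAdmissible n P) (hp : p ∈ P) : p ∉ remaining P i n := by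
  obtain ⟨c, d, h1, h2, h3, rfl⟩ := exists_frame hadm hp i
  have e : i + (d : ZMod n) = i + (c : ZMod n) + ((d - c : ℕ) : ZMod n) := by
    rw [Nat.cast_sub (by omega)]; ring
  rw [e] at hp ⊢
  have h := inside_deleted hadm (by omega) (by omega) hp (fun y => remaining P i (c + y))
    remaining_subset (fun y _ _ => by
      rw [← add_assoc, remaining_succ]; push_cast; rw [add_assoc])
    (c₀ := 0) (d₀ := d - c) (by omega) le_rfl
  simp only [Nat.cast_zero, add_zero] at h
  exact fun hmem => h (remaining_antitone (by omega : c + (d - c + 1) ≤ n) hmem)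

lemma time_spec (hadm : IsAdmissible n P) (hp : p ∈ P) :
    p ∉ remaining P i (time P i p + 1) :=
  Nat.sInf_mem (s := {t | p ∉ remaining P i (t + 1)})
    ⟨n, fun h => notMem_remaining hadm hp (remaining_antitone (Nat.le_succ n) h)⟩

lemma mem_remaining_iff (hadm : IsAdmissible n P) (hp : p ∈ P) :
    p ∈ remaining P i t ↔ t ≤ time P i p := by
  constructor
  · intro h
    by_contra! hlt
    exact time_spec hadm hp (remaining_antitone hlt h)
  · intro h
    cases t with
    | zero => exact hp
    | succ t =>
      by_contra hn
      exact absurd (Nat.sInf_le (show t ∈ {t | p ∉ remaining P i (t + 1)} from hn))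
        (by simpa [time] using h)

lemma time_lt (hadm : IsAdmissible n P) (hp : p ∈ P) : time P i p < n := by
  by_contra! h
  exact notMem_remaining hadm hp ((mem_remaining_iff hadm hp).2 h)

lemma pickCW_time (hadm : IsAdmissible n P) (hp : p ∈ P) :
    pickCW n (remaining P i (time P i p)) (i + (time P i p : ZMod n)) = some p := by
  have h1 : p ∈ remaining P i (time P i p) := (mem_remaining_iff hadm hp).2 le_rfl
  have h2 := time_spec (i := i) hadm hp
  rw [remaining_succ] at h2
  cases h : pickCW n (remaining P i (time P i p)) (i + (time P i p : ZMod n)) with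
  | none => rw [serve_none h] at h2; exact absurd h1 h2
  | some r =>
    rw [serve_some h] at h2
    have : p = r := by
      by_contra hne
      exact h2 (Finset.mem_erase.2 ⟨hne, h1⟩)
    rw [this]

lemma time_eq_of_pickCW (hadm : IsAdmissible n P)
    (h : pickCW n (remaining P i x) (i + (x : ZMod n)) = some p) : p ∈ P ∧ time P i p = x := by
  have h1 := (pickCW_some h).1
  have hp := remaining_subset h1
  refine ⟨hp, le_antisymm ?_ ((mem_remaining_iff hadm hp).1 h1)⟩
  by_contra! hlt
  have h2 := (mem_remaining_iff hadm hp).2 (Nat.succ_le_of_lt hlt)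
  rw [remaining_succ, serve_some h] at h2
  simp at h2

lemma time_inj (hadm : IsAdmissible n P) (hp : p ∈ P) (hq : q ∈ P)
    (h : time P i p = time P i q) : p = q := by
  have h1 := pickCW_time (i := i) hadm hp
  rw [h, pickCW_time hadm hq] at h1
  exact (Option.some.inj h1).symm

lemma time_mem_supp (hadm : IsAdmissible n P) (hp : p ∈ P) :
    i + (time P i p : ZMod n) ∈ supp n p := (pickCW_some (pickCW_time hadm hp)).2.1

lemma time_max (hadm : IsAdmissible n P) (hp : p ∈ P) (hq : q ∈ P)
    (h : time P i p ≤ time P i q) (hv : i + (time P i p : ZMod n) ∈ supp n q) :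
    cwKey n (i + (time P i p : ZMod n)) q ≤ cwKey n (i + (time P i p : ZMod n)) p :=
  (pickCW_some (pickCW_time hadm hp)).2.2 q ((mem_remaining_iff hadm hq).2 h) hv

lemma gnRun_snd (hadm : IsAdmissible n P) {v : ZMod n} :
    (gnRun n P i t).2 p = some v ↔ p ∈ P ∧ time P i p < t ∧ v = i + (time P i p : ZMod n) := by
  induction t with
  | zero => simp [gnRun]
  | succ t ih =>
    rw [gnRun]
    split <;> rename_i h <;> change pickCW n (remaining P i t) _ = _ at h
    · rw [ih]
      refine and_congr_right fun hp => and_congr_left' ?_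
      have := pickCW_time (i := i) hadm hp
      have : time P i p ≠ t := by
        rintro he
        rw [he, h] at this
        simp at this
      omega
    · rename_i r
      obtain ⟨hr, ht⟩ := time_eq_of_pickCW hadm h
      by_cases hpr : p = r
      · subst hpr
        simp [hr, ht, eq_comm]
      · dsimp only
        rw [Function.update_of_ne hpr, ih]
        refine and_congr_right fun hp => and_congr_left' ?_
        have : time P i p ≠ t := fun he => hpr (time_inj hadm hp hr (he.trans ht.symm))
        omega

lemma gnSet_eq (hadm : IsAdmissible n P) :
    gnSet n P i = P.image fun p => i + (time P i p : ZMod n) := by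
  ext v
  simp only [gnSet, gnAssign, gnRun_snd hadm, Finset.mem_filter, Finset.mem_univ, true_and,
    Finset.mem_image]
  exact exists_congr fun p => ⟨fun h => ⟨h.1, h.2.2.symm⟩, fun h => ⟨h.1, time_lt hadm h.1, h.2.symm⟩⟩

lemma add_cast_mem_gnSet (hadm : IsAdmissible n P) (hx : x < n) :
    i + (x : ZMod n) ∈ gnSet n P i ↔ ∃ p ∈ P, time P i p = x := by
  rw [gnSet_eq hadm, Finset.mem_image]
  refine exists_congr fun p => and_congr_right fun hp => ?_
  rw [add_cast_inj i (time_lt hadm hp) hx]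

lemma card_gnSet (hadm : IsAdmissible n P) : (gnSet n P i).card = P.card := by
  rw [gnSet_eq hadm, Finset.card_image_of_injOn]
  intro p hp q hq h
  exact time_inj hadm hp hq ((add_cast_inj i (time_lt hadm hp) (time_lt hadm hq)).1 h)

/-- Started at `a + 2`, the algorithm assigns to `(a, b)` the vertex `b`. -/
lemma time_add_two (hadm : IsAdmissible n P) {a : ZMod n} {m : ℕ} (hm : 2 ≤ m) (hmn : m + 2 ≤ n)
    (hp : s(a, a + (m : ZMod n)) ∈ P) :
    time P (a + 2) s(a, a + (m : ZMod n)) = m - 2 := by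
  have h := inside_deleted hadm hm hmn hp (fun y => remaining P (a + 2) (y - 2))
    remaining_subset (fun y h _ => by
      obtain ⟨y, rfl⟩ := Nat.exists_eq_add_of_le' h
      rw [show y + 2 + 1 - 2 = y + 1 by omega, remaining_succ]
      simp only [Nat.add_sub_cancel]
      push_cast
      congr 1
      ring)
    (c₀ := 0) (d₀ := m) hm le_rfl
  simp only [Nat.cast_zero, add_zero] at h
  rw [mem_remaining_iff hadm hp] at h
  have h1 := time_mem_supp (i := a + 2) hadm hp
  have e : a + 2 + (time P (a + 2) s(a, a + (m : ZMod n)) : ZMod n) =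
      a + ((time P (a + 2) s(a, a + (m : ZMod n)) + 2 : ℕ) : ZMod n) := by push_cast; ring
  have h2 := supp_frame (a := a) (c := 0) (d := m)
    (x := time P (a + 2) s(a, a + (m : ZMod n)) + 2) (by omega) (by omega) (by omega) (by omega)
  rw [Nat.cast_zero, add_zero, ← e] at h2
  have := h2.1 h1
  omega

end Run

section Domino

variable {n : ℕ} [NeZero n] {P : Finset (Prp n)} {i : ZMod n} {p q : Prp n} {t x : ℕ}

lemma remaining_add_one (hadm : IsAdmissible n P) (i : ZMod n) (x : ℕ) :
    remaining P (i + 1) x = remaining P i (x + 1) ∨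
      ∃ r, r ∉ remaining P i (x + 1) ∧ remaining P (i + 1) x = insert r (remaining P i (x + 1)) := by
  induction x with
  | zero =>
    rw [remaining_succ, remaining_zero, remaining_zero]
    simp only [Nat.cast_zero, add_zero]
    cases h : pickCW n P i with
    | none => exact Or.inl (serve_none h).symm
    | some r =>
      right
      rw [serve_some h]
      exact ⟨r, by simp, (Finset.insert_erase (pickCW_some h).1).symm⟩
  | succ x ih =>
    rw [remaining_succ, remaining_succ (t := x + 1)]
    have e : i + ((x + 1 : ℕ) : ZMod n) = i + 1 + (x : ZMod n) := by push_cast; ring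
    rw [e]
    rcases ih with h | ⟨r, hr, h⟩
    · exact Or.inl (by rw [h])
    · rw [h]
      exact serve_insert hadm (h ▸ remaining_subset) hr

omit [NeZero n] in
lemma remaining_add_one_eq_of_le {y : ℕ} (hxy : x ≤ y)
    (h : remaining P (i + 1) x = remaining P i (x + 1)) :
    remaining P (i + 1) y = remaining P i (y + 1) := by
  induction y, hxy using Nat.le_induction with
  | base => exact h
  | succ y _ ih =>
    rw [remaining_succ, ih, remaining_succ (t := y + 1)]
    congr 1
    push_cast; ring

lemma time_le_time_add_one (hadm : IsAdmissible n P) (hp : p ∈ P) :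
    time P i p ≤ time P (i + 1) p + 1 := by
  by_contra! hlt
  have h1 := (mem_remaining_iff (i := i) (t := time P (i + 1) p + 2) hadm hp).2 hlt
  have h2 : p ∉ remaining P (i + 1) (time P (i + 1) p + 1) := time_spec hadm hp
  rcases remaining_add_one hadm i (time P (i + 1) p + 1) with h | ⟨r, -, h⟩
  · exact h2 (h ▸ h1)
  · exact h2 (h ▸ Finset.mem_insert_of_mem h1)

lemma extra_unique (hadm : IsAdmissible n P) (hp : p ∈ P) (hq : q ∈ P)
    (hp1 : time P i p ≤ x) (hp2 : x ≤ time P (i + 1) p)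
    (hq1 : time P i q ≤ x) (hq2 : x ≤ time P (i + 1) q) : p = q := by
  have ep := (mem_remaining_iff (i := i + 1) (t := x) hadm hp).2 hp2
  have eq := (mem_remaining_iff (i := i + 1) (t := x) hadm hq).2 hq2
  have np := (mem_remaining_iff (i := i) (t := x + 1) hadm hp).not.2 (by omega)
  have nq := (mem_remaining_iff (i := i) (t := x + 1) hadm hq).not.2 (by omega)
  rcases remaining_add_one hadm i x with h | ⟨r, -, h⟩
  · exact absurd (h ▸ ep) np
  · rw [h, Finset.mem_insert] at ep eq
    rw [ep.resolve_right np, eq.resolve_right nq]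

/-- The number of steps during which the runs started at `i` and `i + 1` differ. -/
noncomputable def lag (P : Finset (Prp n)) (i : ZMod n) : ℕ :=
  sInf {x | remaining P (i + 1) x = remaining P i (x + 1)}

lemma remaining_eq_empty (hadm : IsAdmissible n P) (h : n ≤ t) : remaining P i t = ∅ := by
  rw [Finset.eq_empty_iff_forall_notMem]
  exact fun p hp => notMem_remaining hadm (remaining_subset hp) (remaining_antitone h hp)

lemma le_lag_iff (hadm : IsAdmissible n P) :
    lag P i ≤ x ↔ remaining P (i + 1) x = remaining P i (x + 1) := by
  have hmem := Nat.sInf_mem (s := {x | remaining P (i + 1) x = remaining P i (x + 1)})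
    ⟨n, by
      change remaining P (i + 1) n = remaining P i (n + 1)
      rw [remaining_eq_empty hadm le_rfl, remaining_eq_empty hadm (by omega)]⟩
  exact ⟨fun h => remaining_add_one_eq_of_le h hmem, fun h => Nat.sInf_le h⟩

lemma lag_le (hadm : IsAdmissible n P) : lag P i ≤ n := by
  rw [le_lag_iff hadm, remaining_eq_empty hadm le_rfl, remaining_eq_empty hadm (by omega)]

lemma lt_lag_iff (hadm : IsAdmissible n P) :
    x < lag P i ↔ ∃ p ∈ P, time P i p ≤ x ∧ x ≤ time P (i + 1) p := by
  rw [← not_le, le_lag_iff hadm]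
  constructor
  · intro h
    obtain ⟨r, hr, h⟩ := (remaining_add_one hadm i x).resolve_left h
    have hr' : r ∈ remaining P (i + 1) x := by rw [h]; exact Finset.mem_insert_self _ _
    have hrP := remaining_subset hr'
    rw [mem_remaining_iff hadm hrP] at hr hr'
    exact ⟨r, hrP, by omega, hr'⟩
  · rintro ⟨p, hp, h1, h2⟩ h
    rw [← mem_remaining_iff hadm hp, h, mem_remaining_iff hadm hp] at h2
    omega

end Domino

section Moves

variable {n : ℕ} [NeZero n] {P : Finset (Prp n)} {i a b : ZMod n} {p q : Prp n} {t x : ℕ}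

lemma exists_length (hadm : IsAdmissible n P) (hq : q ∈ P) (ha : a ∈ q) :
    ∃ m, 2 ≤ m ∧ m + 2 ≤ n ∧ q = s(a, a + (m : ZMod n)) := by
  obtain ⟨c, d, h1, h2, h3, rfl⟩ := exists_frame hadm hq a
  have e : a = a + ((0 : ℕ) : ZMod n) := by simp
  rw [Sym2.mem_iff] at ha
  have ha' : a + ((0 : ℕ) : ZMod n) = a + (c : ZMod n) ∨
      a + ((0 : ℕ) : ZMod n) = a + (d : ZMod n) := by rwa [← e]
  rw [add_cast_inj a (by omega) (by omega), add_cast_inj a (by omega) (by omega)] at ha'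
  obtain rfl : c = 0 := by omega
  exact ⟨d, h1, by omega, by simp⟩

omit [NeZero n] in
lemma cwKey_left {m : ℕ} (hm : 2 ≤ m) (hmn : m + 2 ≤ n) :
    cwKey n a s(a, a + (m : ZMod n)) = m := by
  have h := cwKey_frame_left_self (a := a - 1) (c := 1) (d := m + 1) le_rfl (by omega) (by omega)
  push_cast at h
  rw [show a - 1 + 1 = a by ring, show a - 1 + ((m : ZMod n) + 1) = a + m by ring] at h
  rw [h]

/-- When the propagator `(a, b)` moves off the vertex `a`, it moves to the vertex `a + 1`. -/
lemma time_move (hadm : IsAdmissible n P) (hp : p ∈ P) (ha : a ∈ p)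
    (h1 : i + (time P i p : ZMod n) = a) (h2 : time P i p ≤ time P (i + 1) p) :
    time P (i + 1) p = time P i p := by
  obtain ⟨m, hm, hmn, rfl⟩ := exists_length hadm hp ha
  have hrem := (mem_remaining_iff hadm hp).2 h2
  refine (time_eq_of_pickCW hadm ?_).2
  have hv : i + 1 + (time P i s(a, a + (m : ZMod n)) : ZMod n) = a + 1 := by
    rw [add_right_comm, h1]
  rw [hv]
  refine pickCW_eq hadm remaining_subset hrem (by simp [mem_supp_mk]) fun r hr hrv => ?_
  have hrP := remaining_subset hr
  rw [cwKey_succ, ord_add_cast a (by omega)]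
  by_cases har : a ∈ r
  · by_cases hpr : r = s(a, a + (m : ZMod n))
    · rw [hpr, cwKey_succ, ord_add_cast a (by omega)]
    have hr1 := (mem_remaining_iff hadm hrP).1 hr
    have hlt : time P i s(a, a + (m : ZMod n)) < time P i r := by
      by_contra! hle
      exact hpr (extra_unique hadm hrP hp hle hr1 le_rfl h2)
    obtain ⟨m', hm', hmn', rfl⟩ := exists_length hadm hrP har
    have := time_max hadm hp hrP hlt.le (by rw [h1]; simp [mem_supp_mk])
    rw [h1, cwKey_left hm hmn, cwKey_left hm' hmn'] at this
    rw [cwKey_succ, ord_add_cast a (by omega)]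
    omega
  · have har' : a + 1 - 1 ∉ r := by simpa using har
    rw [cwKey, if_neg har']
    have := ord_lt (a + 1) (otherEnd n r (a + 1))
    omega

/-- The vertex at which `p` is deleted in the run started at `a + 2 + s`, as a position
counted from `a + 2`. -/
noncomputable def position (P : Finset (Prp n)) (a : ZMod n) (p : Prp n) (s : ℕ) : ℕ :=
  s + time P (a + 2 + (s : ZMod n)) p

omit [NeZero n] in
lemma position_succ (s : ℕ) :
    position P a p (s + 1) = s + 1 + time P (a + 2 + (s : ZMod n) + 1) p := by
  rw [position]
  push_cast
  rw [← add_assoc (a + 2)]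

lemma position_mono (hadm : IsAdmissible n P) (hp : p ∈ P) : Monotone (position P a p) :=
  monotone_nat_of_le_succ fun s => by
    have := time_le_time_add_one (i := a + 2 + (s : ZMod n)) hadm hp
    rw [position_succ, position]
    omega

lemma position_mem (hadm : IsAdmissible n P) {c d s : ℕ} (hc : 2 ≤ c) (hcd : c < d) (hd : d ≤ n)
    (hp : s(a + (c : ZMod n), a + (d : ZMod n)) ∈ P)
    (hlt : position P a s(a + (c : ZMod n), a + (d : ZMod n)) s < n) :
    position P a s(a + (c : ZMod n), a + (d : ZMod n)) s + 2 = c ∨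
    position P a s(a + (c : ZMod n), a + (d : ZMod n)) s + 1 = c ∨
    position P a s(a + (c : ZMod n), a + (d : ZMod n)) s + 2 = d ∨
    position P a s(a + (c : ZMod n), a + (d : ZMod n)) s + 1 = d := by
  obtain ⟨c, rfl⟩ := Nat.exists_eq_add_of_le' hc
  obtain ⟨d, rfl⟩ := Nat.exists_eq_add_of_le' (by omega : 2 ≤ d)
  have h := time_mem_supp (i := a + 2 + (s : ZMod n)) hadm hp
  have e0 : a + 2 + (s : ZMod n) + (time P (a + 2 + (s : ZMod n))
      s(a + ((c + 2 : ℕ) : ZMod n), a + ((d + 2 : ℕ) : ZMod n)) : ZMod n) =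
      a + 2 + (position P a s(a + ((c + 2 : ℕ) : ZMod n), a + ((d + 2 : ℕ) : ZMod n)) s : ZMod n) := by
    rw [position]; push_cast; ring
  have e1 : ∀ y : ℕ, a + ((y + 2 : ℕ) : ZMod n) = a + 2 + (y : ZMod n) := by
    intro y; push_cast; ring
  have e2 : ∀ y : ℕ, a + 2 + (y : ZMod n) + 1 = a + 2 + ((y + 1 : ℕ) : ZMod n) := by
    intro y; push_cast; ring
  rw [e0, mem_supp_mk] at h
  generalize position P a s(a + ((c + 2 : ℕ) : ZMod n), a + ((d + 2 : ℕ) : ZMod n)) s = x at *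
  rw [e1, e1, e2, e2, add_cast_inj _ hlt (by omega), add_cast_inj _ hlt (by omega),
    add_cast_inj _ hlt (by omega), add_cast_inj _ hlt (by omega)] at h
  omega

/-- Started at `a + 2`, `p = (a, b)` sits at `b`. -/
lemma position_start (hadm : IsAdmissible n P) {c d : ℕ} (hcd : c + 2 ≤ d) (hdc : d + 2 ≤ c + n)
    (hp : s(a + (c : ZMod n), a + (d : ZMod n)) ∈ P) :
    position P a s(a + (c : ZMod n), a + (d : ZMod n)) c = d - 2 := by
  have e : a + (d : ZMod n) = a + (c : ZMod n) + ((d - c : ℕ) : ZMod n) := by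
    rw [Nat.cast_sub (by omega)]; ring
  rw [e] at hp ⊢
  have := time_add_two hadm (by omega) (by omega) hp
  rw [position, show a + 2 + (c : ZMod n) = a + c + 2 by ring, this]
  omega

lemma half_self (hadm : IsAdmissible n P) {m : ℕ} (hm : 2 ≤ m) (hmn : m + 2 ≤ n)
    (hp : p ∈ P) (hpm : p = s(a, a + (m : ZMod n))) :
    (∑ s ∈ Finset.range m,
      if time P (a + 2 + (s : ZMod n)) p ≤ time P (a + 2 + (s : ZMod n) + 1) p then 1 else 0) = 2 := by
  have hp1 : p = s(a + ((0 : ℕ) : ZMod n), a + (m : ZMod n)) := by simp [hpm]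
  have hp2 : p = s(a + (m : ZMod n), a + (n : ZMod n)) := by simp [hpm]
  have h0 : position P a p 0 = m - 2 := by
    rw [hp1] at hp ⊢
    exact position_start hadm (by omega) (by omega) hp
  have hend : position P a p m = n - 2 := by
    rw [hp2] at hp ⊢
    exact position_start hadm (by omega) (by omega) hp
  have hmem : ∀ s, position P a p s < n → position P a p s + 2 = m ∨
      position P a p s + 1 = m ∨ position P a p s + 2 = n ∨ position P a p s + 1 = n := by
    intro s hs
    rw [hp2] at hp hs ⊢
    exact position_mem hadm (by omega) (by omega) (by omega) hp hs
  have hmono : Monotone (position P a p) := position_mono hadm hp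
  have hmove : ∀ s, position P a p s + 2 = m → position P a p s < position P a p (s + 1) →
      position P a p (s + 1) = m - 1 := by
    intro s h1 h2
    have := time_move (i := a + 2 + (s : ZMod n)) (a := a + (m : ZMod n)) hadm hp
      (by rw [hpm]; simp) (by rw [← h1, position]; push_cast; ring)
      (by rw [position_succ, position] at h2; omega)
    rw [position_succ]
    rw [position] at h1
    omega
  let g : ℕ → ℤ := fun x => if x + 2 = m then 0 else if x + 1 = m then 1 else 2
  have hterm : ∀ s ∈ Finset.range m, ((if time P (a + 2 + (s : ZMod n)) p ≤
      time P (a + 2 + (s : ZMod n) + 1) p then 1 else 0 : ℕ) : ℤ) =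
      g (position P a p (s + 1)) - g (position P a p s) := by
    intro s hs
    rw [Finset.mem_range] at hs
    have e : time P (a + 2 + (s : ZMod n)) p ≤ time P (a + 2 + (s : ZMod n) + 1) p ↔
        position P a p s < position P a p (s + 1) := by
      rw [position_succ, position]
      omega
    have i1 := hmono (Nat.zero_le s)
    have i2 := hmono (Nat.le_succ s)
    have i3 := hmono (show s + 1 ≤ m by omega)
    have i4 := hmem s (by simp only [Nat.succ_eq_add_one] at *; omega)
    have i5 := hmem (s + 1) (by omega)
    have i6 := hmove s
    simp only [e, g, Nat.succ_eq_add_one] at *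
    split_ifs <;> omega
  rw [← Nat.cast_inj (R := ℤ), Nat.cast_sum, Finset.sum_congr rfl hterm, Finset.sum_range_sub (fun s => g (position P a p s)), h0, hend]
  simp only [g]
  split_ifs <;> omega

/-- Deleting `p` before `q` in the run from `i`, and after `q` in the run from `i + 1`. -/
lemma overtake_iff (hadm : IsAdmissible n P) (hp : p ∈ P) (hq : q ∈ P) (hpq : p ≠ q) :
    (time P i p ≤ time P (i + 1) q ∧ time P (i + 1) q ≤ time P (i + 1) p) ↔
      (time P i p < time P i q ∧ time P (i + 1) q < time P (i + 1) p) := by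
  have h1 : time P (i + 1) q ≠ time P (i + 1) p := fun h => hpq (time_inj hadm hq hp h).symm
  have h2 := time_le_time_add_one (i := i) hadm hq
  constructor
  · rintro ⟨h3, h4⟩
    have : ¬ time P i q ≤ time P (i + 1) q :=
      fun h => hpq (extra_unique hadm hp hq h3 h4 h le_rfl)
    omega
  · omega

lemma half_pair (hadm : IsAdmissible n P) {m c d : ℕ} (hm : 2 ≤ m) (hmn : m + 2 ≤ n)
    (hmc : m ≤ c) (hcd : c + 2 ≤ d) (hd : d ≤ n)
    (hp : p ∈ P) (hpm : p = s(a, a + (m : ZMod n)))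
    (hq : q ∈ P) (hqm : q = s(a + (c : ZMod n), a + (d : ZMod n))) (hpq : p ≠ q) :
    (∑ s ∈ Finset.range c,
      if time P (a + 2 + (s : ZMod n)) p < time P (a + 2 + (s : ZMod n)) q ∧
        time P (a + 2 + (s : ZMod n) + 1) q < time P (a + 2 + (s : ZMod n) + 1) p
      then 1 else 0) = 1 ∧
    (∑ s ∈ Finset.range c,
      if time P (a + 2 + (s : ZMod n)) q < time P (a + 2 + (s : ZMod n)) p ∧
        time P (a + 2 + (s : ZMod n) + 1) p < time P (a + 2 + (s : ZMod n) + 1) q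
      then 1 else 0) = 0 := by
  have hp1 : p = s(a + ((0 : ℕ) : ZMod n), a + (m : ZMod n)) := by simp [hpm]
  have hp2 : p = s(a + (m : ZMod n), a + (n : ZMod n)) := by simp [hpm]
  have h0 : position P a p 0 = m - 2 := by
    rw [hp1] at hp ⊢
    exact position_start hadm (by omega) (by omega) hp
  have hend : position P a q c = d - 2 := by
    rw [hqm] at hq ⊢
    exact position_start hadm (by omega) (by omega) hq
  have hmem : ∀ s, position P a p s < n → position P a p s + 2 = m ∨
      position P a p s + 1 = m ∨ position P a p s + 2 = n ∨ position P a p s + 1 = n := by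
    intro s hs
    rw [hp2] at hp hs ⊢
    exact position_mem hadm (by omega) (by omega) (by omega) hp hs
  have hmem' : ∀ s, position P a q s < n → position P a q s + 2 = c ∨
      position P a q s + 1 = c ∨ position P a q s + 2 = d ∨ position P a q s + 1 = d := by
    intro s hs
    rw [hqm] at hq hs ⊢
    exact position_mem hadm (by omega) (by omega) (by omega) hq hs
  have hmono : Monotone (position P a p) := position_mono hadm hp
  have hmono' : Monotone (position P a q) := position_mono hadm hq
  have hlt : ∀ {u v : Prp n} {s : ℕ}, time P (a + 2 + (s : ZMod n)) u <
      time P (a + 2 + (s : ZMod n)) v ↔ position P a u s < position P a v s := by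
    intro u v s
    unfold position
    omega
  have hlt' : ∀ {u v : Prp n} {s : ℕ}, time P (a + 2 + (s : ZMod n) + 1) u <
      time P (a + 2 + (s : ZMod n) + 1) v ↔
      position P a u (s + 1) < position P a v (s + 1) := by
    intro u v s
    rw [position_succ, position_succ]
    omega
  have hne : ∀ s, position P a p s ≠ position P a q s := fun s h =>
    hpq (time_inj (i := a + 2 + (s : ZMod n)) hadm hp hq (by unfold position at h; omega))
  have hlt0 : position P a q 0 < n := by
    have := time_lt (i := a + 2 + ((0 : ℕ) : ZMod n)) hadm hq
    rw [position]; omega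
  have hple : c ≤ position P a p c := by rw [position]; omega
  have hno : ∀ s < c, ¬ (position P a q s < position P a p s ∧
      position P a p (s + 1) < position P a q (s + 1)) := by
    rintro s hs ⟨h1, h2⟩
    have i0 := hmem' 0 hlt0
    have i1 := hmono' (Nat.zero_le s)
    have i2 := hmono (Nat.le_succ s)
    have i3 := hmono' (show s + 1 ≤ c by omega)
    have i4 := hmono' (Nat.le_succ s)
    simp only [Nat.succ_eq_add_one] at i2 i4
    have i5 := hmem s (by omega)
    have i6 := hmem' s (by omega)
    have i7 : position P a q s + 2 = c ∧ c = m := by omega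
    obtain rfl := i7.2
    have h3 := time_max (i := a + 2 + (s : ZMod n)) hadm hq hp (by unfold position at h1; omega)
    have e : a + 2 + (s : ZMod n) + (time P (a + 2 + (s : ZMod n)) q : ZMod n) =
        a + (c : ZMod n) := by
      rw [← i7.1, position]; push_cast; ring
    rw [e] at h3
    have ep : p = s(a + (c : ZMod n), a + (c : ZMod n) + ((n - c : ℕ) : ZMod n)) := by
      rw [Nat.cast_sub (by omega), hp2]; ring_nf
    have eq : q = s(a + (c : ZMod n), a + (c : ZMod n) + ((d - c : ℕ) : ZMod n)) := by
      rw [Nat.cast_sub (by omega), hqm]; ring_nf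
    have hdn : d ≠ n := by
      rintro rfl
      exact hpq (hp2.trans hqm.symm)
    have h4 : a + (c : ZMod n) ∈ supp n p := by rw [ep]; simp [mem_supp_mk]
    have h5 := h3 h4
    rw [ep, cwKey_left (by omega) (by omega), eq, cwKey_left (by omega) (by omega)] at h5
    omega
  have hz : (∑ s ∈ Finset.range c,
      if time P (a + 2 + (s : ZMod n)) q < time P (a + 2 + (s : ZMod n)) p ∧
        time P (a + 2 + (s : ZMod n) + 1) p < time P (a + 2 + (s : ZMod n) + 1) q
      then 1 else 0) = 0 := by
    apply Finset.sum_eq_zero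
    intro s hs
    rw [if_neg]
    rw [hlt, hlt']
    exact hno s (Finset.mem_range.1 hs)
  refine ⟨?_, hz⟩
  let g : ℕ → ℤ := fun s => if position P a q s < position P a p s then 1 else 0
  have hterm : ∀ s ∈ Finset.range c, ((if time P (a + 2 + (s : ZMod n)) p <
      time P (a + 2 + (s : ZMod n)) q ∧ time P (a + 2 + (s : ZMod n) + 1) q <
        time P (a + 2 + (s : ZMod n) + 1) p then 1 else 0 : ℕ) : ℤ) = g (s + 1) - g s := by
    intro s hs
    have := hno s (Finset.mem_range.1 hs)
    have := hne s
    have := hne (s + 1)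
    simp only [g, hlt, hlt']
    split_ifs <;> omega
  rw [← Nat.cast_inj (R := ℤ), Nat.cast_sum, Finset.sum_congr rfl hterm, Finset.sum_range_sub g]
  have j0 := hmem' 0 hlt0
  have j1 := hne 0
  have j2 := hne c
  have j3 := hmem c
  simp only [g]
  rw [if_pos (by omega), if_neg (by omega)]
  norm_num

end Moves

section Count

variable {n : ℕ} [NeZero n] {P : Finset (Prp n)} {i a b : ZMod n} {p q : Prp n} {t x : ℕ}

lemma sum_zmod {M : Type*} [AddCommMonoid M] (f : ZMod n → M) (a : ZMod n) :
    ∑ i, f i = ∑ s ∈ Finset.range n, f (a + (s : ZMod n)) := by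
  refine (Finset.sum_nbij (fun s : ℕ => a + (s : ZMod n)) (by simp) ?_ ?_ (by simp)).symm
  · intro s hs t ht h
    simp only [Finset.coe_range, Set.mem_Iio] at hs ht
    exact (add_cast_inj a hs ht).1 h
  · intro v _
    exact ⟨ord n a v, by simpa using ord_lt a v, add_ord a v⟩

lemma sum_zmod_split {M : Type*} [AddCommMonoid M] (f : ZMod n → M) (a : ZMod n) {m : ℕ}
    (hm : m ≤ n) :
    ∑ i, f i = ∑ s ∈ Finset.range m, f (a + 2 + (s : ZMod n)) +
      ∑ s ∈ Finset.range (n - m), f (a + (m : ZMod n) + 2 + (s : ZMod n)) := by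
  rw [sum_zmod f (a + 2)]
  nth_rw 1 [← Nat.add_sub_cancel' hm]
  rw [Finset.sum_range_add]
  congr 1
  refine Finset.sum_congr rfl fun s _ => ?_
  congr 1
  push_cast; ring

lemma sum_moves (hadm : IsAdmissible n P) (hp : p ∈ P) :
    ∑ i, (if time P i p ≤ time P (i + 1) p then 1 else 0) = 4 := by
  obtain ⟨a, ha⟩ : ∃ a, a ∈ p := by
    induction p using Sym2.ind with
    | _ x y => exact ⟨x, Sym2.mem_mk_left x y⟩
  obtain ⟨m, hm, hmn, hpm⟩ := exists_length hadm hp ha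
  have hpm' : p = s(a + (m : ZMod n), a + (m : ZMod n) + ((n - m : ℕ) : ZMod n)) := by
    rw [hpm, Sym2.eq_swap, Nat.cast_sub (by omega)]; simp
  rw [sum_zmod_split _ a (by omega : m ≤ n), half_self hadm hm hmn hp hpm,
    half_self hadm (by omega) (by omega) hp hpm']

lemma exists_disjoint_frame (hadm : IsAdmissible n P) (hp : p ∈ P) (hq : q ∈ P) (hpq : p ≠ q) :
    ∃ (a : ZMod n) (m c d : ℕ), 2 ≤ m ∧ m + 2 ≤ n ∧ m ≤ c ∧ c + 2 ≤ d ∧ d + 2 ≤ c + n ∧ d ≤ n ∧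
      p = s(a, a + (m : ZMod n)) ∧ q = s(a + (c : ZMod n), a + (d : ZMod n)) := by
  obtain ⟨a, ha⟩ : ∃ a, a ∈ p := by
    induction p using Sym2.ind with
    | _ x y => exact ⟨x, Sym2.mem_mk_left x y⟩
  obtain ⟨m, hm, hmn, hpm⟩ := exists_length hadm hp ha
  obtain ⟨c, d, h1, h2, h3, hqc⟩ := exists_frame hadm hq a
  have hnc : ¬ (0 < c ∧ c < m ∧ m < d) := by
    rw [hpm] at hp
    rw [hqc] at hq
    exact not_crossing_frame (a := a) (c := 0) (d := m) hadm h3 (by simpa using hp) hq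
  by_cases hmc : m ≤ c
  · exact ⟨a, m, c, d, hm, hmn, hmc, h1, h2, h3.le, hpm, hqc⟩
  rcases le_or_gt d m with hdm | hdm
  · refine ⟨a + (m : ZMod n), n - m, c + (n - m), d + (n - m), by omega, by omega, by omega,
      by omega, by omega, by omega, ?_, ?_⟩
    · rw [hpm, Sym2.eq_swap, Nat.cast_sub (by omega)]; simp
    · rw [hqc]
      push_cast [Nat.cast_sub (by omega : m ≤ n)]
      simp only [ZMod.natCast_self]
      ring_nf
  · obtain rfl : c = 0 := by omega
    have hne : d ≠ m := by omega
    refine ⟨a, m, d, n, hm, hmn, by omega, by omega, by omega, le_rfl, hpm, ?_⟩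
    rw [hqc, Sym2.eq_swap]
    simp

lemma sum_overtake (hadm : IsAdmissible n P) (hp : p ∈ P) (hq : q ∈ P) (hpq : p ≠ q) :
    ∑ i, (if time P i p ≤ time P (i + 1) q ∧ time P (i + 1) q ≤ time P (i + 1) p then 1 else 0)
      = 1 := by
  obtain ⟨a, m, c, d, hm, hmn, hmc, hcd, hdc, hd, hpm, hqm⟩ := exists_disjoint_frame hadm hp hq hpq
  have hp' : p = s(a + (c : ZMod n) + ((n - c : ℕ) : ZMod n),
      a + (c : ZMod n) + ((n - c + m : ℕ) : ZMod n)) := by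
    rw [hpm]
    push_cast [Nat.cast_sub (by omega : c ≤ n)]
    simp only [ZMod.natCast_self]
    ring_nf
  have hq' : q = s(a + (c : ZMod n), a + (c : ZMod n) + ((d - c : ℕ) : ZMod n)) := by
    rw [hqm, Nat.cast_sub (by omega)]; ring_nf
  simp only [overtake_iff hadm hp hq hpq]
  rw [sum_zmod_split _ a (by omega : c ≤ n), (half_pair hadm hm hmn hmc hcd hd hp hpm hq hqm hpq).1,
    (half_pair hadm (by omega) (by omega) (by omega) (by omega) (by omega) hq hq' hp hp'
      hpq.symm).2]

/-- Going once around, the runs started at `i` and `i + 1` disagree exactly once on whether `p`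
has been deleted when `w` is reached. -/
lemma sum_extra_vertex (hadm : IsAdmissible n P) (hp : p ∈ P) (w : ZMod n) :
    ∑ i, (if time P i p ≤ ord n (i + 1) w ∧ ord n (i + 1) w ≤ time P (i + 1) p then 1 else 0)
      = 1 := by
  have hn := hadm.card_add_four_le
  obtain ⟨k, hk⟩ := Nat.exists_eq_add_of_le' (by omega : 1 ≤ n)
  let g : ℕ → ℤ := fun s => if k - s ≤ time P (w + 1 + (s : ZMod n)) p then 1 else 0
  have hord : ∀ s ≤ k, ord n (w + 1 + (s : ZMod n)) w = k - s := by
    intro s hs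
    have e : w = w + 1 + (k : ZMod n) := by
      have : ((k + 1 : ℕ) : ZMod n) = 0 := by rw [← hk, ZMod.natCast_self]
      push_cast at this
      rw [add_assoc, add_comm 1, this, add_zero]
    nth_rw 2 [e]
    rw [ord_add_add hs (by omega)]
  have hsucc : ∀ s : ℕ, w + 1 + (s : ZMod n) + 1 = w + 1 + ((s + 1 : ℕ) : ZMod n) := by
    intro s; push_cast; ring
  have hterm : ∀ s ∈ Finset.range k, ((if time P (w + 1 + (s : ZMod n)) p ≤
      ord n (w + 1 + (s : ZMod n) + 1) w ∧ ord n (w + 1 + (s : ZMod n) + 1) w ≤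
      time P (w + 1 + (s : ZMod n) + 1) p then 1 else 0 : ℕ) : ℤ) = g (s + 1) - g s := by
    intro s hs
    rw [Finset.mem_range] at hs
    have := time_le_time_add_one (i := w + 1 + (s : ZMod n)) hadm hp
    simp only [g, hsucc, hord (s + 1) hs] at this ⊢
    split_ifs <;> omega
  have hlast : w + 1 + (k : ZMod n) + 1 = w + 1 + ((0 : ℕ) : ZMod n) := by
    have : ((k + 1 : ℕ) : ZMod n) = 0 := by rw [← hk, ZMod.natCast_self]
    rw [hsucc, this]; simp
  have hlt := time_lt (i := w + 1 + (k : ZMod n)) hadm hp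
  rw [sum_zmod _ (w + 1), ← Nat.cast_inj (R := ℤ), Nat.cast_sum]
  simp only [hk]
  rw [Finset.sum_range_succ, Finset.sum_congr rfl hterm, Finset.sum_range_sub g, hlast,
    hord 0 (Nat.zero_le _)]
  simp only [g]
  split_ifs <;> omega

lemma sum_extra (hadm : IsAdmissible n P) :
    ∑ p ∈ P, (if time P i p ≤ x ∧ x ≤ time P (i + 1) p then 1 else 0) =
      if x < lag P i then 1 else 0 := by
  split_ifs with h
  · obtain ⟨p, hp, h1, h2⟩ := (lt_lag_iff hadm).1 h
    rw [Finset.sum_eq_single_of_mem p hp, if_pos ⟨h1, h2⟩]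
    intro q hq hne
    exact if_neg fun h3 => hne (extra_unique hadm hq hp h3.1 h3.2 h1 h2)
  · refine Finset.sum_eq_zero fun p hp => if_neg fun h3 => h ?_
    exact (lt_lag_iff hadm).2 ⟨p, hp, h3⟩

lemma sum_lag (hadm : IsAdmissible n P) (f : ZMod n → ℕ) :
    ∑ x ∈ Finset.range (lag P i), f (i + 1 + (x : ZMod n)) =
      ∑ v, if ord n (i + 1) v < lag P i then f v else 0 := by
  rw [sum_zmod _ (i + 1), ← Finset.sum_filter]
  refine Finset.sum_congr ?_ fun _ _ => rfl
  ext x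
  simp only [Finset.mem_range, Finset.mem_filter]
  constructor
  · intro h
    have hx := h.trans_le (lag_le hadm)
    exact ⟨hx, by rwa [ord_add_cast _ hx]⟩
  · rintro ⟨hx, h⟩
    rwa [ord_add_cast _ hx] at h

lemma sum_lag_mem (hadm : IsAdmissible n P) (A : Finset (ZMod n)) :
    ∑ x ∈ Finset.range (lag P i), (if i + 1 + (x : ZMod n) ∈ A then 1 else 0) =
      ∑ v ∈ A, ∑ p ∈ P,
        if time P i p ≤ ord n (i + 1) v ∧ ord n (i + 1) v ≤ time P (i + 1) p then 1 else 0 := by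
  rw [sum_lag hadm (fun v => if v ∈ A then 1 else 0)]
  simp only [sum_extra hadm]
  rw [← Finset.sum_filter_add_sum_filter_not Finset.univ (· ∈ A), Finset.filter_univ_mem]
  rw [Finset.sum_eq_zero (s := Finset.univ.filter fun v => v ∉ A), add_zero]
  · refine Finset.sum_congr rfl fun v hv => ?_
    simp [hv]
  · intro v hv
    simp [(Finset.mem_filter.1 hv).2]

lemma sum_new_fixed (hadm : IsAdmissible n P) :
    ∑ i, ∑ x ∈ Finset.range (lag P i), (if i + 1 + (x : ZMod n) ∈ gnSet n P 1 then 1 else 0) =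
      P.card * P.card := by
  simp only [sum_lag_mem hadm]
  rw [Finset.sum_comm]
  have : ∀ w ∈ gnSet n P 1, ∑ i, ∑ p ∈ P, (if time P i p ≤ ord n (i + 1) w ∧
      ord n (i + 1) w ≤ time P (i + 1) p then 1 else 0) = P.card := by
    intro w _
    rw [Finset.sum_comm, Finset.sum_congr rfl fun p hp => sum_extra_vertex hadm hp w]
    simp
  rw [Finset.sum_congr rfl this, Finset.sum_const, card_gnSet hadm, smul_eq_mul]

lemma sum_new_moving (hadm : IsAdmissible n P) :
    ∑ i, ∑ x ∈ Finset.range (lag P i), (if i + 1 + (x : ZMod n) ∈ gnSet n P (i + 1) then 1 else 0) =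
      P.card * P.card + 3 * P.card := by
  have h1 : ∀ i, ∑ x ∈ Finset.range (lag P i),
      (if i + 1 + (x : ZMod n) ∈ gnSet n P (i + 1) then 1 else 0) =
      ∑ q ∈ P, ∑ p ∈ P, if time P i p ≤ time P (i + 1) q ∧ time P (i + 1) q ≤ time P (i + 1) p
        then 1 else 0 := by
    intro i
    rw [sum_lag_mem hadm, gnSet_eq hadm, Finset.sum_image]
    · refine Finset.sum_congr rfl fun q hq => ?_
      rw [ord_add_cast _ (time_lt hadm hq)]
    · intro p hp q hq h
      exact time_inj hadm hp hq ((add_cast_inj _ (time_lt hadm hp) (time_lt hadm hq)).1 h)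
  simp only [h1]
  rw [Finset.sum_comm]
  have h2 : ∀ q ∈ P, ∑ i, ∑ p ∈ P, (if time P i p ≤ time P (i + 1) q ∧
      time P (i + 1) q ≤ time P (i + 1) p then 1 else 0) = P.card + 3 := by
    intro q hq
    rw [Finset.sum_comm, ← Finset.add_sum_erase P _ hq]
    rw [Finset.sum_congr rfl fun p hp => sum_overtake hadm (Finset.mem_of_mem_erase hp) hq
      (Finset.ne_of_mem_erase hp)]
    simp only [le_refl, and_true]
    rw [sum_moves hadm hq, Finset.sum_const, Finset.card_erase_of_mem hq]
    have := Finset.card_pos.2 ⟨q, hq⟩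
    simp only [smul_eq_mul]
    omega
  rw [Finset.sum_congr rfl h2, Finset.sum_const, smul_eq_mul]
  ring

end Count

section Rank

variable {A B : Finset ℕ}

lemma card_gt_bijOn (A : Finset ℕ) :
    (∀ a ∈ A, (A.filter fun x => a < x).card ∈ Finset.range A.card) ∧
    (∀ a ∈ A, ∀ a' ∈ A, (A.filter fun x => a < x).card = (A.filter fun x => a' < x).card →
      a = a') := by
  have hlt : ∀ a ∈ A, ∀ a' ∈ A, a < a' →
      (A.filter fun x => a' < x).card < (A.filter fun x => a < x).card := by
    intro a _ a' ha' h
    refine Finset.card_lt_card (Finset.ssubset_iff_of_subset ?_ |>.2 ⟨a', ?_, ?_⟩)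
    · exact Finset.monotone_filter_right _ fun x _ hx => h.trans hx
    · simp [ha', h]
    · simp
  refine ⟨fun a ha => ?_, fun a ha a' ha' h => ?_⟩
  · rw [Finset.mem_range]
    exact Finset.card_lt_card (Finset.filter_ssubset.2 ⟨a, ha, by simp⟩)
  · rcases lt_trichotomy a a' with h1 | h1 | h1
    · exact absurd h (hlt a ha a' ha' h1).ne'
    · exact h1
    · exact absurd h (hlt a' ha' a ha h1).ne

lemma card_lt_bijOn (B : Finset ℕ) :
    (∀ b ∈ B, (B.filter fun x => x < b).card ∈ Finset.range B.card) ∧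
    (∀ b ∈ B, ∀ b' ∈ B, (B.filter fun x => x < b).card = (B.filter fun x => x < b').card →
      b = b') := by
  have hlt : ∀ b ∈ B, ∀ b' ∈ B, b < b' →
      (B.filter fun x => x < b).card < (B.filter fun x => x < b').card := by
    intro b hb b' _ h
    refine Finset.card_lt_card (Finset.ssubset_iff_of_subset ?_ |>.2 ⟨b, ?_, ?_⟩)
    · exact Finset.monotone_filter_right _ fun x _ hx => lt_trans hx h
    · simp [hb, h]
    · simp
  refine ⟨fun a ha => ?_, fun a ha a' ha' h => ?_⟩
  · rw [Finset.mem_range]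
    exact Finset.card_lt_card (Finset.filter_ssubset.2 ⟨a, ha, by simp⟩)
  · rcases lt_trichotomy a a' with h1 | h1 | h1
    · exact absurd h (hlt a ha a' ha' h1).ne
    · exact h1
    · exact absurd h (hlt a' ha' a ha h1).ne'

/-- The pairs matching the decreasingly ordered `A` with the increasingly ordered `B`. -/
def pairing (A B : Finset ℕ) : Finset (ℕ × ℕ) :=
  (A ×ˢ B).filter fun z => (A.filter fun x => z.1 < x).card = (B.filter fun y => y < z.2).card

lemma mem_pairing {a b : ℕ} : (a, b) ∈ pairing A B ↔
    a ∈ A ∧ b ∈ B ∧ (A.filter fun x => a < x).card = (B.filter fun y => y < b).card := by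
  simp [pairing, and_assoc]

lemma card_pairing_snd (h : A.card = B.card) (Q : ℕ → Prop) [DecidablePred Q] :
    ((pairing A B).filter fun z => Q z.2).card = (B.filter Q).card := by
  refine Finset.card_bij (fun z _ => z.2) ?_ ?_ ?_
  · rintro ⟨a, b⟩ hz
    rw [Finset.mem_filter, mem_pairing] at hz
    exact Finset.mem_filter.2 ⟨hz.1.2.1, hz.2⟩
  · rintro ⟨a, b⟩ hz ⟨a', b'⟩ hz' (rfl : b = b')
    rw [Finset.mem_filter, mem_pairing] at hz hz'
    rw [(card_gt_bijOn A).2 a hz.1.1 a' hz'.1.1 (hz.1.2.2.trans hz'.1.2.2.symm)]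
  · intro b hb
    rw [Finset.mem_filter] at hb
    obtain ⟨a, ha, he⟩ := Finset.surj_on_of_inj_on_of_card_le
      (fun a (_ : a ∈ A) => (A.filter fun x => a < x).card) (t := Finset.range A.card)
      (fun a ha => (card_gt_bijOn A).1 a ha)
      (fun a a' ha ha' => (card_gt_bijOn A).2 a ha a' ha') (by simp)
      _ (h ▸ (card_lt_bijOn B).1 b hb.1)
    exact ⟨(a, b), Finset.mem_filter.2 ⟨mem_pairing.2 ⟨ha, hb.1, he.symm⟩, hb.2⟩, rfl⟩

lemma card_pairing_fst (h : A.card = B.card) (Q : ℕ → Prop) [DecidablePred Q] :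
    ((pairing A B).filter fun z => Q z.1).card = (A.filter Q).card := by
  refine Finset.card_bij (fun z _ => z.1) ?_ ?_ ?_
  · rintro ⟨a, b⟩ hz
    rw [Finset.mem_filter, mem_pairing] at hz
    exact Finset.mem_filter.2 ⟨hz.1.1, hz.2⟩
  · rintro ⟨a, b⟩ hz ⟨a', b'⟩ hz' (rfl : a = a')
    rw [Finset.mem_filter, mem_pairing] at hz hz'
    rw [(card_lt_bijOn B).2 b hz.1.2.1 b' hz'.1.2.1 (hz.1.2.2.symm.trans hz'.1.2.2)]
  · intro a ha
    rw [Finset.mem_filter] at ha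
    obtain ⟨b, hb, he⟩ := Finset.surj_on_of_inj_on_of_card_le
      (fun b (_ : b ∈ B) => (B.filter fun x => x < b).card) (t := Finset.range B.card)
      (fun b hb => (card_lt_bijOn B).1 b hb)
      (fun b b' hb hb' => (card_lt_bijOn B).2 b hb b' hb') (by simp)
      _ (h ▸ (card_gt_bijOn A).1 a ha.1)
    exact ⟨(a, b), Finset.mem_filter.2 ⟨mem_pairing.2 ⟨ha.1, hb, he⟩, ha.2⟩, rfl⟩

end Rank

section Necklace

/-- A Grassmann necklace `X 0, …, X n = X 0` in the positions `0, …, n - 1`: the step from `X m`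
to `X (m + 1)` moves the element `m`, if present, forward by `J m`. -/
structure IsNecklace (n k : ℕ) (X : ℕ → Finset ℕ) (J : ℕ → ℕ) : Prop where
  subset : ∀ m, X m ⊆ Finset.range n
  card : ∀ m, (X m).card = k
  closed : X n = X 0
  le : ∀ m, J m ≤ n
  stay : ∀ m < n, J m = 0 → X (m + 1) = X m
  mem : ∀ m < n, 1 ≤ J m → m ∈ X m
  move_lt : ∀ m < n, 1 ≤ J m → m + J m < n →
    m + J m ∉ X m ∧ X (m + 1) = insert (m + J m) ((X m).erase m)
  move_ge : ∀ m < n, n ≤ m + J m →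
    m + J m - n ∉ (X m).erase m ∧ X (m + 1) = insert (m + J m - n) ((X m).erase m)

variable {n k : ℕ} {X : ℕ → Finset ℕ} {J : ℕ → ℕ}

namespace IsNecklace

lemma mem_succ (h : IsNecklace n k X J) {m v : ℕ} (hm : m < n) (hv : v ∈ X m) (hne : v ≠ m) :
    v ∈ X (m + 1) := by
  rcases Nat.eq_zero_or_pos (J m) with h0 | h0
  · rwa [h.stay m hm h0]
  · rcases lt_or_ge (m + J m) n with h1 | h1
    · rw [(h.move_lt m hm h0 h1).2]
      simp [hv, hne]
    · rw [(h.move_ge m hm h1).2]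
      simp [hv, hne]

lemma mem_of_le (h : IsNecklace n k X J) {m m' v : ℕ} (hmm : m ≤ m') (hm' : m' ≤ n)
    (hv : v ∈ X m) (hout : v < m ∨ m' ≤ v) : v ∈ X m' := by
  induction m', hmm using Nat.le_induction with
  | base => exact hv
  | succ m' hle ih => exact h.mem_succ (by omega) (ih (by omega) (by omega)) (by omega)

lemma mem_of_mem_zero (h : IsNecklace n k X J) {m v : ℕ} (hm : m ≤ n) (hv : v ∈ X 0)
    (hmv : m ≤ v) : v ∈ X m :=
  h.mem_of_le (Nat.zero_le m) hm hv (Or.inr hmv)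

lemma mem_zero_of_mem (h : IsNecklace n k X J) {m v : ℕ} (hm : m ≤ n) (hv : v ∈ X m)
    (hmv : v < m) : v ∈ X 0 :=
  h.closed ▸ h.mem_of_le hm le_rfl hv (Or.inl hmv)

lemma mem_pairing_iff (h : IsNecklace n k X J) {m a b : ℕ} (hm : m ≤ n) :
    (a, b) ∈ pairing (X 0 \ X m) (X m \ X 0) ↔ a ∈ X 0 \ X m ∧ b ∈ X m \ X 0 ∧ a < m ∧ m ≤ b ∧
      (X 0 ∩ Finset.Ioo a b).card = (X m ∩ Finset.Ioo a b).card := by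
  rw [mem_pairing]
  refine and_congr_right fun ha => and_congr_right fun hb => ?_
  have hA : ∀ v ∈ X 0 \ X m, v < m := fun v hv => by
    rw [Finset.mem_sdiff] at hv
    by_contra! hmv
    exact hv.2 (h.mem_of_mem_zero hm hv.1 hmv)
  have hB : ∀ v ∈ X m \ X 0, m ≤ v := fun v hv => by
    rw [Finset.mem_sdiff] at hv
    by_contra! hmv
    exact hv.2 (h.mem_zero_of_mem hm hv.1 hmv)
  have h1 := hA a ha
  have h2 := hB b hb
  have e1 : ((X 0 \ X m).filter fun x => a < x) =
      (X 0 ∩ Finset.Ioo a b) \ (X m ∩ Finset.Ioo a b) := by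
    ext v
    have := hA v
    simp only [Finset.mem_filter, Finset.mem_sdiff, Finset.mem_inter, Finset.mem_Ioo] at this ⊢
    constructor
    · rintro ⟨hv, hav⟩
      have := this hv
      refine ⟨⟨hv.1, hav, by omega⟩, fun hv' => hv.2 hv'.1⟩
    · rintro ⟨⟨hv, hav, hvb⟩, hv'⟩
      exact ⟨⟨hv, fun hvm => hv' ⟨hvm, hav, hvb⟩⟩, hav⟩
  have e2 : ((X m \ X 0).filter fun x => x < b) =
      (X m ∩ Finset.Ioo a b) \ (X 0 ∩ Finset.Ioo a b) := by
    ext v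
    have := hB v
    simp only [Finset.mem_filter, Finset.mem_sdiff, Finset.mem_inter, Finset.mem_Ioo] at this ⊢
    constructor
    · rintro ⟨hv, hav⟩
      have := this hv
      refine ⟨⟨hv.1, by omega, hav⟩, fun hv' => hv.2 hv'.1⟩
    · rintro ⟨⟨hv, hav, hvb⟩, hv'⟩
      exact ⟨⟨hv, fun hvm => hv' ⟨hvm, hav, hvb⟩⟩, hvb⟩
  rw [e1, e2]
  have := Finset.card_sdiff_add_card_inter (X 0 ∩ Finset.Ioo a b) (X m ∩ Finset.Ioo a b)
  have := Finset.card_sdiff_add_card_inter (X m ∩ Finset.Ioo a b) (X 0 ∩ Finset.Ioo a b)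
  have := congrArg Finset.card
    (Finset.inter_comm (X m ∩ Finset.Ioo a b) (X 0 ∩ Finset.Ioo a b))
  omega

lemma card_Ioo_succ_le (h : IsNecklace n k X J) {m a b : ℕ} (hm : m < n) (ham : a < m)
    (hmb : m < b) : (X (m + 1) ∩ Finset.Ioo a b).card ≤ (X m ∩ Finset.Ioo a b).card := by
  rcases Nat.eq_zero_or_pos (J m) with h0 | h0
  · rw [h.stay m hm h0]
  obtain ⟨z, hz⟩ : ∃ z, X (m + 1) = insert z ((X m).erase m) := by
    rcases lt_or_ge (m + J m) n with h1 | h1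
    · exact ⟨_, (h.move_lt m hm h0 h1).2⟩
    · exact ⟨_, (h.move_ge m hm h1).2⟩
  have hmem : m ∈ X m ∩ Finset.Ioo a b := by simp [h.mem m hm h0, ham, hmb]
  rw [hz]
  calc _ ≤ (insert z ((X m ∩ Finset.Ioo a b).erase m)).card := by
        refine Finset.card_le_card fun v hv => ?_
        simp only [Finset.mem_inter, Finset.mem_insert, Finset.mem_erase] at hv ⊢
        tauto
    _ ≤ ((X m ∩ Finset.Ioo a b).erase m).card + 1 := Finset.card_insert_le _ _
    _ = _ := Finset.card_erase_add_one hmem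

lemma card_Ioo_antitone (h : IsNecklace n k X J) {m m' a b : ℕ} (hmm : m ≤ m') (hm : m' ≤ n)
    (ham : a < m) (hmb : m' ≤ b) :
    (X m' ∩ Finset.Ioo a b).card ≤ (X m ∩ Finset.Ioo a b).card := by
  induction m', hmm using Nat.le_induction with
  | base => exact le_rfl
  | succ m' hle ih =>
    exact (h.card_Ioo_succ_le (by omega) (by omega) (by omega)).trans (ih (by omega) (by omega))

lemma pairing_convex (h : IsNecklace n k X J) {i j l : ℕ} {z : ℕ × ℕ} (hij : i ≤ j) (hjl : j ≤ l)
    (hl : l ≤ n) (hi : z ∈ pairing (X 0 \ X i) (X i \ X 0))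
    (hk : z ∈ pairing (X 0 \ X l) (X l \ X 0)) : z ∈ pairing (X 0 \ X j) (X j \ X 0) := by
  obtain ⟨a, b⟩ := z
  rw [h.mem_pairing_iff (m := i) (by omega)] at hi
  rw [h.mem_pairing_iff (m := l) (by omega)] at hk
  rw [h.mem_pairing_iff (m := j) (by omega)]
  simp only [Finset.mem_sdiff] at *
  obtain ⟨ha, hb, h1, h2, h3⟩ := hi
  obtain ⟨ha', hb', h1', h2', h3'⟩ := hk
  have := h.card_Ioo_antitone hij (by omega) h1 (by omega : j ≤ b)
  have := h.card_Ioo_antitone hjl hl (by omega : a < j) h2'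
  exact ⟨⟨ha.1, fun hj => ha'.2 (h.mem_of_le hjl hl hj (Or.inl (by omega)))⟩,
    ⟨h.mem_of_le hij (by omega) hb.1 (Or.inr (by omega)), hb.2⟩, by omega, by omega, by omega⟩

lemma card_biUnion_pairing (h : IsNecklace n k X J) {M : ℕ} (hM : M ≤ n) :
    ((Finset.range (M + 1)).biUnion fun m => pairing (X 0 \ X m) (X m \ X 0)).card =
      ∑ m ∈ Finset.range M, (pairing (X 0 \ X (m + 1)) (X (m + 1) \ X 0) \
        pairing (X 0 \ X m) (X m \ X 0)).card := by
  induction M with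
  | zero => simp [pairing]
  | succ M ih =>
    rw [Finset.range_add_one, Finset.biUnion_insert, Finset.sum_range_succ, ← ih (by omega),
      ← Finset.sdiff_union_self_eq_union, Finset.card_union_of_disjoint Finset.sdiff_disjoint,
      add_comm]
    congr 2
    ext z
    simp only [Finset.mem_sdiff, Finset.mem_biUnion, Finset.mem_range, not_exists, not_and]
    refine and_congr_right fun hz => ⟨fun hn => hn M (by omega), fun hn m hm hz' => hn ?_⟩
    exact h.pairing_convex (by omega) (Nat.le_succ M) hM hz' hz

lemma card_sdiff_eq (h : IsNecklace n k X J) (m : ℕ) :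
    (X 0 \ X m).card = (X m \ X 0).card :=
  Finset.card_sdiff_comm ((h.card 0).trans (h.card m).symm)

lemma card_insert_erase_Ioo {Y : Finset ℕ} {m z a b : ℕ} (hm : m ∈ Y) (hz : z ∉ Y) :
    ((insert z (Y.erase m) ∩ Finset.Ioo a b).card : ℤ) =
      (Y ∩ Finset.Ioo a b).card - (if a < m ∧ m < b then 1 else 0) +
        (if a < z ∧ z < b then 1 else 0) := by
  have hzm : z ∉ Y.erase m := fun h => hz (Finset.mem_of_mem_erase h)
  simp only [← Finset.filter_mem_eq_inter, Finset.mem_Ioo, Finset.card_filter]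
  rw [Finset.sum_insert hzm, ← Finset.add_sum_erase Y _ hm]
  push_cast
  ring

lemma sdiff_pairing_lt (h : IsNecklace n k X J) {m : ℕ} (hm : m < n) (hJ : 1 ≤ J m)
    (hz : m + J m < n) :
    pairing (X 0 \ X (m + 1)) (X (m + 1) \ X 0) \ pairing (X 0 \ X m) (X m \ X 0) =
      (pairing (X 0 \ X (m + 1)) (X (m + 1) \ X 0)).filter fun z => z.2 ≤ m + J m := by
  obtain ⟨h1, h2⟩ := h.move_lt m hm hJ hz
  have h3 := h.mem m hm hJ
  have hz0 : m + J m ∉ X 0 := fun hz0 => h1 (h.mem_of_mem_zero hm.le hz0 (by omega))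
  ext ⟨a, b⟩
  rw [Finset.mem_sdiff, Finset.mem_filter]
  refine and_congr_right fun hab => ?_
  rw [h.mem_pairing_iff (by omega)] at hab ⊢
  have hcard := card_insert_erase_Ioo (a := a) (b := b) h3 h1
  rw [← h2] at hcard
  simp only [Finset.mem_sdiff] at hab ⊢
  obtain ⟨⟨ha0, ha⟩, ⟨hb, hb0⟩, ham, hmb, hc⟩ := hab
  have hbm : b ∈ X m ↔ b ≠ m + J m := by
    rw [h2] at hb
    constructor
    · rintro hb' rfl; exact h1 hb'
    · intro hne
      simp only [Finset.mem_insert, Finset.mem_erase] at hb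
      tauto
  have ham' : a ∉ X m ↔ a ≠ m := by
    rw [h2] at ha
    constructor
    · rintro ha' rfl; exact ha' h3
    · intro hne ha'
      exact ha (by simp [hne, ha'])
  have hgt : m + J m < b → a ≠ m := by
    rintro hlt rfl
    refine hc.not_lt (Finset.card_lt_card
      (Finset.ssubset_iff_of_subset ?_ |>.2 ⟨a + J a, ?_, ?_⟩))
    · intro v hv
      rw [Finset.mem_inter, Finset.mem_Ioo] at hv ⊢
      exact ⟨h.mem_of_mem_zero (by omega) hv.1 (by omega), hv.2⟩
    · rw [Finset.mem_inter, Finset.mem_Ioo, h2]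
      exact ⟨Finset.mem_insert_self _ _, by omega, hlt⟩
    · simp [hz0]
  rw [hbm, ham']
  split_ifs at hcard <;> simp only [ha0, hb0, true_and, not_false_eq_true, and_true] <;> omega

lemma sdiff_pairing_ge (h : IsNecklace n k X J) {m : ℕ} (hm : m < n) (hz : n ≤ m + J m) :
    pairing (X 0 \ X (m + 1)) (X (m + 1) \ X 0) \ pairing (X 0 \ X m) (X m \ X 0) =
      (pairing (X 0 \ X (m + 1)) (X (m + 1) \ X 0)).filter fun z => m + J m - n < z.1 := by
  obtain ⟨h1, h2⟩ := h.move_ge m hm hz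
  have h3 := h.mem m hm (by omega)
  have hJn := h.le m
  generalize hzd : m + J m - n = z at *
  rcases (by omega : z = m ∨ z < m) with rfl | hzm
  · rw [Finset.insert_erase h3] at h2
    rw [h2, Finset.sdiff_self, eq_comm, Finset.filter_eq_empty_iff]
    rintro ⟨a, b⟩ hab
    rw [h.mem_pairing_iff (by omega)] at hab
    omega
  have h1' : z ∉ X m := by simpa [hzm.ne] using h1
  ext ⟨a, b⟩
  rw [Finset.mem_sdiff, Finset.mem_filter]
  refine and_congr_right fun hab => ?_
  rw [h.mem_pairing_iff (by omega)] at hab ⊢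
  have hcard := card_insert_erase_Ioo (a := a) (b := b) h3 h1'
  rw [← h2] at hcard
  simp only [Finset.mem_sdiff] at hab ⊢
  obtain ⟨⟨ha0, ha⟩, ⟨hb, hb0⟩, ham, hmb, hc⟩ := hab
  have hbm : b ∈ X m := by
    rw [h2] at hb
    simp only [Finset.mem_insert, Finset.mem_erase] at hb
    have : b ≠ z := by omega
    tauto
  have haz : a ≠ z := by
    rintro rfl
    exact ha (h2 ▸ Finset.mem_insert_self _ _)
  have ham' : a ∉ X m ↔ a ≠ m := by
    rw [h2] at ha
    constructor
    · rintro ha' rfl; exact ha' h3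
    · intro hne ha'
      exact ha (by simp [hne, ha'])
  rw [ham']
  split_ifs at hcard <;> simp only [ha0, hb0, hbm, true_and, not_false_eq_true, and_true] <;> omega

lemma card_sdiff_pairing (h : IsNecklace n k X J) {m : ℕ} (hm : m < n) :
    ((pairing (X 0 \ X (m + 1)) (X (m + 1) \ X 0) \ pairing (X 0 \ X m) (X m \ X 0)).card : ℤ) =
      ∑ x ∈ Finset.range (J m), ((if (m + 1 + x) % n ∈ X (m + 1) then 1 else 0) -
        (if (m + 1 + x) % n ∈ X 0 then 1 else 0)) := by
  rcases Nat.eq_zero_or_pos (J m) with h0 | h0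
  · rw [h.stay m hm h0, h0]; simp
  let f : ℕ → ℤ := fun y => (if y ∈ X (m + 1) then 1 else 0) - (if y ∈ X 0 then 1 else 0)
  have hsum : ∀ s : Finset ℕ, ∑ y ∈ s, f y = ((X (m + 1) \ X 0 ∩ s).card : ℤ) -
      (X 0 \ X (m + 1) ∩ s).card := by
    intro s
    simp only [Finset.inter_comm _ s, ← Finset.filter_mem_eq_inter, Finset.card_filter]
    push_cast
    rw [← Finset.sum_sub_distrib]
    refine Finset.sum_congr rfl fun y _ => ?_
    simp only [f, Finset.mem_sdiff]
    split_ifs <;> first | rfl | (exfalso; tauto)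
  have hcard := h.card_sdiff_eq (m + 1)
  rcases lt_or_ge (m + J m) n with hz | hz
  · rw [h.sdiff_pairing_lt hm h0 hz, card_pairing_snd hcard (· ≤ m + J m)]
    have hshift : ∑ x ∈ Finset.range (J m), ((if (m + 1 + x) % n ∈ X (m + 1) then 1 else 0) -
        (if (m + 1 + x) % n ∈ X 0 then 1 else 0)) =
        ∑ y ∈ Finset.Ico (m + 1) (m + 1 + J m), f y := by
      rw [Finset.sum_Ico_eq_sum_range, Nat.add_sub_cancel_left]
      refine Finset.sum_congr rfl fun x hx => ?_
      rw [Finset.mem_range] at hx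
      rw [Nat.mod_eq_of_lt (by omega)]
    have hB : X (m + 1) \ X 0 ∩ Finset.Ico (m + 1) (m + 1 + J m) =
        (X (m + 1) \ X 0).filter (· ≤ m + J m) := by
      ext v
      have := h.mem_zero_of_mem (m := m + 1) (v := v) (by omega)
      grind
    have hA : X 0 \ X (m + 1) ∩ Finset.Ico (m + 1) (m + 1 + J m) = ∅ := by
      ext v
      have := h.mem_of_mem_zero (m := m + 1) (v := v) (by omega)
      grind
    rw [hshift, hsum, hA, hB]
    simp
  · rw [h.sdiff_pairing_ge hm hz, card_pairing_fst hcard (m + J m - n < ·)]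
    have hJn := h.le m
    obtain ⟨z, hzd⟩ : ∃ z, z = m + J m - n := ⟨_, rfl⟩
    have hJ : J m = (n - (m + 1)) + (z + 1) := by omega
    have hshift : ∑ x ∈ Finset.range (J m), ((if (m + 1 + x) % n ∈ X (m + 1) then 1 else 0) -
        (if (m + 1 + x) % n ∈ X 0 then 1 else 0)) =
        ∑ y ∈ Finset.Ico (m + 1) n, f y + ∑ y ∈ Finset.range (z + 1), f y := by
      rw [hJ, Finset.sum_range_add, Finset.sum_Ico_eq_sum_range]
      congr 1 <;> refine Finset.sum_congr rfl fun x hx => ?_ <;> rw [Finset.mem_range] at hx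
      · rw [Nat.mod_eq_of_lt (by omega)]
      · rw [show m + 1 + (n - (m + 1) + x) = x + n by omega, Nat.add_mod_right,
          Nat.mod_eq_of_lt (by omega)]
    have htot : ∑ y ∈ Finset.range n, f y = 0 := by
      rw [hsum, Finset.inter_eq_left.2 (Finset.sdiff_subset.trans (h.subset _)),
        Finset.inter_eq_left.2 (Finset.sdiff_subset.trans (h.subset _)), hcard, sub_self]
    rw [← Finset.sum_range_add_sum_Ico f (by omega : m + 1 ≤ n),
      ← Finset.sum_range_add_sum_Ico f (by omega : z + 1 ≤ m + 1), hsum (Finset.Ico (z + 1) _)]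
      at htot
    have hB : X (m + 1) \ X 0 ∩ Finset.Ico (z + 1) (m + 1) = ∅ := by
      ext v
      have := h.mem_zero_of_mem (m := m + 1) (v := v) (by omega)
      grind
    have hA : X 0 \ X (m + 1) ∩ Finset.Ico (z + 1) (m + 1) =
        (X 0 \ X (m + 1)).filter (m + J m - n < ·) := by
      ext v
      have := h.mem_of_mem_zero (m := m + 1) (v := v) (by omega)
      grind
    rw [hA, hB, Finset.card_empty] at htot
    rw [hshift]
    omega

end IsNecklace

end Necklace

section Bridge

variable {n : ℕ} [NeZero n] {P : Finset (Prp n)} {i : ZMod n} {m w x y : ℕ}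

lemma card_remaining (hadm : IsAdmissible n P) (hx : x < n) :
    (remaining P i x).card = (remaining P i (x + 1)).card +
      if i + (x : ZMod n) ∈ gnSet n P i then 1 else 0 := by
  simp only [add_cast_mem_gnSet hadm hx]
  rw [remaining_succ]
  cases h : pickCW n (remaining P i x) (i + (x : ZMod n)) with
  | none =>
    rw [serve_none h, if_neg, add_zero]
    rintro ⟨p, hp, rfl⟩
    rw [pickCW_time hadm hp] at h
    exact Option.some_ne_none _ h
  | some r =>
    have hr := (pickCW_some h).1
    rw [serve_some h, if_pos ⟨r, time_eq_of_pickCW hadm h⟩,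
      Finset.card_erase_add_one hr]

lemma card_remaining_add_one (hadm : IsAdmissible n P) :
    (remaining P (i + 1) x).card = (remaining P i (x + 1)).card +
      if x < lag P i then 1 else 0 := by
  split_ifs with h
  · rw [← not_le, le_lag_iff hadm] at h
    obtain ⟨r, hr, h⟩ := (remaining_add_one hadm i x).resolve_left h
    rw [h, Finset.card_insert_of_notMem hr]
  · rw [not_lt, le_lag_iff hadm] at h
    rw [h, add_zero]

lemma self_mem_gnSet_iff (hadm : IsAdmissible n P) : i ∈ gnSet n P i ↔ 0 < lag P i := by
  have h1 := card_remaining (i := i) hadm (NeZero.pos n)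
  have h2 := card_remaining_add_one (i := i) (x := 0) hadm
  rw [Nat.cast_zero, add_zero, remaining_zero] at h1
  rw [remaining_zero] at h2
  split_ifs at h1 h2 <;> simp_all

lemma self_mem_gnSet_add_one_iff (hadm : IsAdmissible n P) :
    i ∈ gnSet n P (i + 1) ↔ lag P i = n := by
  have hn := NeZero.pos n
  have h1 := card_remaining (i := i + 1) (x := n - 1) hadm (by omega)
  have h2 := card_remaining_add_one (i := i) (x := n - 1) hadm
  rw [Nat.sub_add_cancel hn, remaining_eq_empty hadm le_rfl] at h1 h2
  have e : i + 1 + ((n - 1 : ℕ) : ZMod n) = i := by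
    rw [Nat.cast_sub hn]; simp
  rw [e] at h1
  have := lag_le (i := i) hadm
  rw [h1] at h2
  split_ifs at h2 with h3 h4 h4
  · simp only [h3, true_iff]; omega
  · omega
  · omega
  · simp only [h3, false_iff]; omega

lemma add_cast_mem_gnSet_add_one (hadm : IsAdmissible n P) (hy : 1 ≤ y) (hyn : y < n) :
    (i + (y : ZMod n) ∈ gnSet n P (i + 1) ↔ i + (y : ZMod n) ∈ gnSet n P i ∨ y = lag P i) ∧
      (y = lag P i → i + (y : ZMod n) ∉ gnSet n P i) := by
  obtain ⟨x, rfl⟩ := Nat.exists_eq_add_of_le' hy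
  have h1 := card_remaining (i := i + 1) (x := x) hadm (by omega)
  have h2 := card_remaining_add_one (i := i) (x := x) hadm
  have h3 := card_remaining_add_one (i := i) (x := x + 1) hadm
  have h4 := card_remaining (i := i) hadm hyn
  have e : i + 1 + (x : ZMod n) = i + ((x + 1 : ℕ) : ZMod n) := by push_cast; ring
  rw [e] at h1
  by_cases c1 : i + ((x + 1 : ℕ) : ZMod n) ∈ gnSet n P (i + 1) <;>
    by_cases c2 : i + ((x + 1 : ℕ) : ZMod n) ∈ gnSet n P i <;>
    simp only [c1, c2, if_true, if_false, true_iff, false_iff, true_or, false_or, not_true_eq_false,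
      not_false_eq_true, imp_false, imp_true_iff, and_true, true_and, false_and] at h1 h4 ⊢ <;>
    split_ifs at h2 h3 <;> omega

/-- The positions of the vertices of the necklace term `I_{1 + m}` in the order `<₁`. -/
noncomputable def positions (P : Finset (Prp n)) (m : ℕ) : Finset ℕ :=
  (gnSet n P (1 + (m : ZMod n))).image (ord n 1)

lemma ord_injective (a : ZMod n) : Function.Injective (ord n a) := fun x y h => by
  rw [← add_ord a x, h, add_ord]

lemma mem_positions (hw : w < n) :
    w ∈ positions P m ↔ 1 + (w : ZMod n) ∈ gnSet n P (1 + (m : ZMod n)) := by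
  rw [positions, ← (ord_injective 1).mem_finset_image (s := gnSet n P _), ord_add_cast 1 hw]

lemma isNecklace_positions (hadm : IsAdmissible n P) :
    IsNecklace n P.card (positions P) fun m => lag P (1 + (m : ZMod n)) := by
  have hsub : ∀ m, positions P m ⊆ Finset.range n := by
    intro m w hw
    obtain ⟨v, -, rfl⟩ := Finset.mem_image.1 hw
    exact Finset.mem_range.2 (ord_lt 1 v)
  have hle : ∀ m : ℕ, lag P (1 + (m : ZMod n)) ≤ n := fun m => lag_le hadm
  have hs : ∀ m : ℕ, 1 + ((m + 1 : ℕ) : ZMod n) = 1 + (m : ZMod n) + 1 := by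
    intro m; push_cast; ring
  have hmem : ∀ m w, w ∈ positions P m → w < n := fun m w hw => Finset.mem_range.1 (hsub m hw)
  have hself : ∀ m < n, m ∈ positions P m ↔ 0 < lag P (1 + (m : ZMod n)) := fun m hm => by
    rw [mem_positions hm, self_mem_gnSet_iff hadm]
  have hself' : ∀ m < n, m ∈ positions P (m + 1) ↔ lag P (1 + (m : ZMod n)) = n := fun m hm => by
    rw [mem_positions hm, hs, self_mem_gnSet_add_one_iff hadm]
  have hgt : ∀ m w, m < w → w < n → (w ∈ positions P (m + 1) ↔
      w ∈ positions P m ∨ w = m + lag P (1 + (m : ZMod n))) ∧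
      (w = m + lag P (1 + (m : ZMod n)) → w ∉ positions P m) := by
    intro m w hmw hw
    have h := add_cast_mem_gnSet_add_one (i := 1 + (m : ZMod n)) (y := w - m) hadm (by omega)
      (by omega)
    have e : 1 + (m : ZMod n) + ((w - m : ℕ) : ZMod n) = 1 + (w : ZMod n) := by
      rw [Nat.cast_sub hmw.le]; ring
    rw [e] at h
    have e2 : w - m = lag P (1 + (m : ZMod n)) ↔ w = m + lag P (1 + (m : ZMod n)) := by omega
    rw [mem_positions hw, mem_positions hw, hs, ← e2]
    exact h
  have hlt : ∀ m w, w < m → m < n → (w ∈ positions P (m + 1) ↔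
      w ∈ positions P m ∨ w + n = m + lag P (1 + (m : ZMod n))) ∧
      (w + n = m + lag P (1 + (m : ZMod n)) → w ∉ positions P m) := by
    intro m w hmw hm
    have h := add_cast_mem_gnSet_add_one (i := 1 + (m : ZMod n)) (y := w + n - m) hadm (by omega)
      (by omega)
    have e : 1 + (m : ZMod n) + ((w + n - m : ℕ) : ZMod n) = 1 + (w : ZMod n) := by
      rw [Nat.cast_sub (by omega), Nat.cast_add, ZMod.natCast_self]; ring
    rw [e] at h
    have e2 : w + n - m = lag P (1 + (m : ZMod n)) ↔ w + n = m + lag P (1 + (m : ZMod n)) := by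
      omega
    rw [mem_positions (by omega), mem_positions (by omega), hs, ← e2]
    exact h
  refine ⟨hsub, fun m => ?_, by simp [positions], hle, ?_, ?_, ?_, ?_⟩
  · rw [positions, Finset.card_image_of_injective _ (ord_injective 1), card_gnSet hadm]
  · intro m hm h0
    ext w
    rcases lt_or_ge w n with hw | hw
    · have := hself m hm
      have := hself' m hm
      have := hgt m w
      have := hlt m w
      grind
    · exact iff_of_false (fun h => by have := hmem _ _ h; omega)
        (fun h => by have := hmem _ _ h; omega)
  · exact fun m hm h => (hself m hm).2 h
  · intro m hm h1 h2
    refine ⟨(hgt m _ (by omega) h2).2 rfl, ?_⟩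
    ext w
    rw [Finset.mem_insert, Finset.mem_erase]
    rcases lt_or_ge w n with hw | hw
    · have := hself m hm
      have := hself' m hm
      have := hgt m w
      have := hlt m w
      grind
    · exact iff_of_false (fun h => by have := hmem _ _ h; omega)
        (fun h => by rcases h with h | h; omega; have := hmem _ _ h.2; omega)
  · intro m hm h1
    have hlem := hle m
    refine ⟨fun hc => ?_, ?_⟩
    · rw [Finset.mem_erase] at hc
      exact (hlt m _ (by omega) hm).2 (by omega) hc.2
    ext w
    rw [Finset.mem_insert, Finset.mem_erase]
    rcases lt_or_ge w n with hw | hw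
    · have := hself m hm
      have := hself' m hm
      have := hgt m w
      have := hlt m w
      grind
    · exact iff_of_false (fun h => by have := hmem _ _ h; omega)
        (fun h => by rcases h with h | h; omega; have := hmem _ _ h.2; omega)

lemma lePlusAt_iff {a b : ZMod n} :
    LePlusAt n (gnSet n P 1) (gnSet n P (1 + (m : ZMod n))) a b ↔
      (ord n 1 a, ord n 1 b) ∈ pairing (positions P 0 \ positions P m)
        (positions P m \ positions P 0) := by
  have hinj := ord_injective (1 : ZMod n)
  have h0 : positions P 0 = (gnSet n P 1).image (ord n 1) := by simp [positions]
  rw [mem_pairing, h0, positions, ← Finset.image_sdiff _ _ hinj, ← Finset.image_sdiff _ _ hinj,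
    hinj.mem_finset_image, hinj.mem_finset_image, Finset.filter_image, Finset.filter_image,
    Finset.card_image_of_injective _ hinj, Finset.card_image_of_injective _ hinj]
  rfl

lemma plusCount_eq_card_biUnion : plusCount n P = ((Finset.range (n + 1)).biUnion fun m =>
    pairing (positions P 0 \ positions P m) (positions P m \ positions P 0)).card := by
  have hinj := ord_injective (1 : ZMod n)
  rw [plusCount, ← Finset.card_image_of_injective _ (hinj.prodMap hinj)]
  congr 1
  ext ⟨x, y⟩
  simp only [Finset.mem_image, Finset.mem_filter, Finset.mem_univ, true_and, Prod.exists,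
    Prod.map_apply, Prod.mk.injEq, Finset.mem_biUnion, Finset.mem_range]
  constructor
  · rintro ⟨a, b, ⟨i, hi⟩, rfl, rfl⟩
    rw [← add_ord 1 i, lePlusAt_iff] at hi
    exact ⟨ord n 1 i, by have := ord_lt 1 i; omega, hi⟩
  · rintro ⟨m, -, h⟩
    have h' := mem_pairing.1 h
    obtain ⟨a, -, rfl⟩ := Finset.mem_image.1 (Finset.mem_sdiff.1 h'.1).1
    obtain ⟨b, -, rfl⟩ := Finset.mem_image.1 (Finset.mem_sdiff.1 h'.2.1).1
    exact ⟨a, b, ⟨_, lePlusAt_iff.2 h⟩, rfl, rfl⟩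

end Bridge

/-- dimension of the Wilson loop cells.
Let `W = (P, [n])` be an admissible Wilson loop diagram.  Then the number of
`+` entries in the Le diagram of `W` equals `3·|P|`; equivalently (since the
number of plusses of the Le diagram equals the dimension of the corresponding
positroid cell), the dimension of the positroid cell of `M(W)` in
`Gr_{≥0}(|P|, n)` is three times the number of propagators of `W`. -/
theorem plusCount_eq_three_mul_card
    (n : ℕ) [NeZero n] (P : Finset (Prp n)) (hadm : IsAdmissible n P) :
    plusCount n P = 3 * P.card := by
  have hneck := isNecklace_positions hadm
  have hpos : ∀ m x m' : ℕ, (m + 1 + x) % n ∈ positions P m' ↔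
      1 + (m : ZMod n) + 1 + (x : ZMod n) ∈ gnSet n P (1 + (m' : ZMod n)) := by
    intro m x m'
    rw [mem_positions (Nat.mod_lt _ (NeZero.pos n)), ZMod.natCast_mod]
    push_cast
    ring_nf
  have hfixed := congrArg (Nat.cast : ℕ → ℤ) (sum_new_fixed hadm)
  have hmoving := congrArg (Nat.cast : ℕ → ℤ) (sum_new_moving hadm)
  rw [sum_zmod _ 1] at hfixed hmoving
  push_cast at hfixed hmoving
  have hcount : (plusCount n P : ℤ) = 3 * P.card := by
    rw [plusCount_eq_card_biUnion, hneck.card_biUnion_pairing le_rfl, Nat.cast_sum,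
      Finset.sum_congr rfl fun m hm => hneck.card_sdiff_pairing (Finset.mem_range.1 hm)]
    simp only [hpos, Finset.sum_sub_distrib, Nat.cast_zero, add_zero, Nat.cast_add, Nat.cast_one,
      ← add_assoc]
    rw [hfixed, hmoving]
    ring
  exact_mod_cast hcount

end WLD
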